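/- Hadamard powers of the sphere Gram matrix are approximate identities plus explicit spikes (Lemma F.5). Fix an integer k ≥ 3 and constants C₀, D₀ > 0. There exist constants K, C > 0 depending only on k, C₀, D₀ such that for any d ≥ C and any p with 1 ≤ p ≤ C₀d², if w₁,…,w_p are i.i.d. uniform on the unit sphere S^{d−1}, W ∈ ℝ^{p×d} has rows w_iᵀ, and M ∈ ℝ^{p×p} is the k-th entrywise (Hadamard) power of the Gram matrix, M_{ij} := ⟨w_i, w_j⟩^k, then with probability at least 1 − p^{−D₀}: if k = 3, ‖M − I_p − (3/d)·WWᵀ‖_op ≤ (log d)^K/√d; if k = 4, ‖M − I_p − (3/d²)·1_p1_pᵀ‖_op ≤ (log d)^K/√d; and if k ≥ 5, ‖M − I_p‖_op ≤ (log d)^K/√d. In particular, on this event ‖M‖_op ≤ C' for a constant C' depending only on k, C₀, D₀. -/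

import Mathlib

/-!
Hadamard powers of the sphere Gram matrix are approximate identities plus explicit
spikes (Lemma F.5).
-/

noncomputable section

set_option linter.unusedSectionVars false
set_option linter.unusedVariables false

open MeasureTheory ProbabilityTheory

/-- Euclidean dot product on `ι → ℝ`. -/
def dotp {ι : Type*} [Fintype ι] (u v : ι → ℝ) : ℝ := ∑ i, u i * v i

/-- Euclidean norm on `ι → ℝ`. -/
def enorm2 {ι : Type*} [Fintype ι] (u : ι → ℝ) : ℝ := Real.sqrt (∑ i, (u i) ^ 2)

/-- The standard Gaussian measure on `ι → ℝ`. -/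
def stdG (ι : Type*) [Fintype ι] : Measure (ι → ℝ) :=
  Measure.pi fun _ => gaussianReal 0 1

/-- The uniform distribution on the unit sphere of `ι → ℝ`, realized as the law of a
normalized standard Gaussian vector. -/
def unifSphere (ι : Type*) [Fintype ι] : Measure (ι → ℝ) :=
  (stdG ι).map fun x => (enorm2 x)⁻¹ • x

/-- The `ℓ² → ℓ²` operator norm of a matrix. -/
def opNorm {ι κ : Type*} [Fintype ι] [Fintype κ] (A : ι → κ → ℝ) : ℝ :=
  ⨆ v : {v : κ → ℝ // (∑ j, (v j) ^ 2) ≤ 1},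
    Real.sqrt (∑ i, (∑ j, A i j * v.1 j) ^ 2)

section MomentLemma

open Matrix

lemma hp_young (x : ℝ) (hx : 0 ≤ x) (j q : ℕ) (hjq : j ≤ q) (hq : 0 < q) :
    x ^ j ≤ ((q : ℝ) - j) / q + j / q * x ^ q := by
  have hq' : (0 : ℝ) < q := by exact_mod_cast hq
  have hj : (j : ℝ) ≤ q := by exact_mod_cast hjq
  have h := Real.geom_mean_le_arith_mean2_weighted (w₁ := ((q : ℝ) - j) / q) (w₂ := j / q)
    (p₁ := 1) (p₂ := x ^ q) (div_nonneg (by linarith) hq'.le) (by positivity) zero_le_one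
    (by positivity) (by field_simp; ring)
  rw [Real.one_rpow, one_mul, ← Real.rpow_natCast x q, ← Real.rpow_mul hx] at h
  have e : (q : ℝ) * (j / q) = j := by field_simp
  rw [e, Real.rpow_natCast, Real.rpow_natCast] at h
  linarith

variable {κ : Type*} [Fintype κ] [DecidableEq κ]

lemma hp_spec (S : Matrix κ κ ℝ) (hS : S.PosSemidef) (v : κ → ℝ) :
    ∃ c l : κ → ℝ, (∀ k, 0 ≤ c k) ∧ (∀ k, 0 ≤ l k) ∧
      ∀ j : ℕ, v ⬝ᵥ (S ^ j *ᵥ v) = ∑ k, c k * l k ^ j := by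
  set U : Matrix κ κ ℝ := (hS.1.eigenvectorUnitary : Matrix κ κ ℝ) with hU
  set l := hS.1.eigenvalues with hl
  have h1 : S = U * diagonal l * Uᵀ := by
    have := hS.1.spectral_theorem
    rw [Unitary.conjStarAlgAut_apply] at this
    simpa [Matrix.star_eq_conjTranspose] using this
  have h2 : Uᵀ * U = 1 := by
    have := Unitary.coe_star_mul_self hS.1.eigenvectorUnitary
    simpa [Matrix.star_eq_conjTranspose] using this
  have h2' : U * Uᵀ = 1 := by
    have := Unitary.coe_mul_star_self hS.1.eigenvectorUnitary
    simpa [Matrix.star_eq_conjTranspose] using this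
  have h3 : ∀ j : ℕ, S ^ j = U * diagonal (fun k => l k ^ j) * Uᵀ := by
    intro j
    induction j with
    | zero => simp [h2']
    | succ n ih =>
      rw [pow_succ, ih]
      conv_lhs => rw [h1]
      rw [show U * diagonal (fun k => l k ^ n) * Uᵀ * (U * diagonal l * Uᵀ)
        = U * diagonal (fun k => l k ^ n) * (Uᵀ * U) * diagonal l * Uᵀ by
          simp only [Matrix.mul_assoc], h2, Matrix.mul_one, Matrix.mul_assoc U,
          diagonal_mul_diagonal]
      simp only [pow_succ]
  refine ⟨fun k => ((Uᵀ *ᵥ v) k) ^ 2, l, fun k => sq_nonneg _,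
    fun k => hS.eigenvalues_nonneg k, fun j => ?_⟩
  rw [h3 j, ← mulVec_mulVec, ← mulVec_mulVec, dotProduct_mulVec, ← mulVec_transpose]
  simp only [dotProduct, mulVec_diagonal]
  refine Finset.sum_congr rfl fun k _ => by ring

lemma hp_interp (S : Matrix κ κ ℝ) (hS : S.PosSemidef) (v : κ → ℝ) (b A : ℝ) (hA : 0 < A)
    (q : ℕ) (hq : 0 < q)
    (h0 : v ⬝ᵥ v ≤ b) (hqa : v ⬝ᵥ (S ^ q *ᵥ v) ≤ b * A ^ q) (j : ℕ) (hj : j ≤ q) :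
    v ⬝ᵥ (S ^ j *ᵥ v) ≤ b * A ^ j := by
  obtain ⟨c, l, hc, hl, H⟩ := hp_spec S hS v
  have h0' : ∑ k, c k ≤ b := by
    have := H 0
    simp only [pow_zero, one_mulVec, mul_one] at this
    linarith
  rw [H q] at hqa
  rw [H j]
  have hq' : (0 : ℝ) < q := by exact_mod_cast hq
  have hj' : (j : ℝ) ≤ q := by exact_mod_cast hj
  have key : ∀ k, c k * l k ^ j ≤
      ((q : ℝ) - j) / q * A ^ j * c k + j / q * (A ^ j / A ^ q) * (c k * l k ^ q) := by
    intro k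
    have h := hp_young (l k / A) (div_nonneg (hl k) hA.le) j q hj hq
    rw [div_pow, div_pow, div_le_iff₀ (by positivity)] at h
    have := mul_le_mul_of_nonneg_left h (hc k)
    refine this.trans (le_of_eq ?_)
    field_simp
  calc ∑ k, c k * l k ^ j ≤ ∑ k, (((q : ℝ) - j) / q * A ^ j * c k
        + j / q * (A ^ j / A ^ q) * (c k * l k ^ q)) := Finset.sum_le_sum fun k _ => key k
    _ = ((q : ℝ) - j) / q * A ^ j * ∑ k, c k + j / q * (A ^ j / A ^ q) * ∑ k, c k * l k ^ q := by
        rw [Finset.sum_add_distrib, Finset.mul_sum, Finset.mul_sum]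
    _ ≤ ((q : ℝ) - j) / q * A ^ j * b + j / q * (A ^ j / A ^ q) * (b * A ^ q) := by
        have : 0 ≤ ((q : ℝ) - j) / q := div_nonneg (by linarith) hq'.le
        gcongr
    _ = b * A ^ j := by field_simp; ring

lemma hp_step1 (S : Matrix κ κ ℝ) (y : κ → ℝ) (b A : ℝ) (hA : 0 < A) (hb : 0 < b) (q : ℕ)
    (h : ∀ j ≤ q, y ⬝ᵥ (S ^ j *ᵥ y) ≤ b * A ^ j) (hnn : ∀ j, 0 ≤ y ⬝ᵥ (S ^ j *ᵥ y)) :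
    ∀ n r : ℕ, r + n ≤ q →
      y ⬝ᵥ (S ^ r *ᵥ ((S + vecMulVec y y) ^ n *ᵥ y)) ≤ b * A ^ r * (A + b) ^ n := by
  intro n
  induction n with
  | zero => intro r hr; simpa using h r (by omega)
  | succ n ih =>
    intro r hr
    have e : y ⬝ᵥ (S ^ r *ᵥ ((S + vecMulVec y y) ^ (n + 1) *ᵥ y)) =
        y ⬝ᵥ (S ^ (r + 1) *ᵥ ((S + vecMulVec y y) ^ n *ᵥ y))
        + (y ⬝ᵥ (S ^ r *ᵥ y)) * (y ⬝ᵥ (S ^ 0 *ᵥ ((S + vecMulVec y y) ^ n *ᵥ y))) := by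
      rw [pow_succ' (S + vecMulVec y y), ← mulVec_mulVec, add_mulVec, mulVec_add, dotProduct_add,
        mulVec_mulVec, ← pow_succ, vecMulVec_mulVec]
      simp [mulVec_smul, dotProduct_smul, mul_comm]
    rw [e]
    have h1 := ih (r + 1) (by omega)
    have h2 := ih 0 (by omega)
    have h3 := h r (by omega)
    have h4 := hnn r
    calc _ ≤ b * A ^ (r + 1) * (A + b) ^ n + (b * A ^ r) * (b * A ^ 0 * (A + b) ^ n) := by
          refine add_le_add h1 (mul_le_mul_of_nonneg_left h2 h4 |>.trans ?_)
          exact mul_le_mul_of_nonneg_right h3 (by positivity)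
      _ = _ := by ring

lemma hp_psd_pow_nonneg (S : Matrix κ κ ℝ) (hS : S.PosSemidef) (v : κ → ℝ) (j : ℕ) :
    0 ≤ v ⬝ᵥ (S ^ j *ᵥ v) := by
  obtain ⟨c, l, hc, hl, H⟩ := hp_spec S hS v
  rw [H]
  exact Finset.sum_nonneg fun k _ => mul_nonneg (hc k) (pow_nonneg (hl k) _)

lemma hp_step2 (S : Matrix κ κ ℝ) (hS : S.PosSemidef) (y : κ → ℝ) (b : ℝ) (hb : 0 < b)
    (hy : y ⬝ᵥ y ≤ b) (q : ℕ) :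
    y ⬝ᵥ ((S + vecMulVec y y) ^ q *ᵥ y) ≤
      Real.exp 1 * (y ⬝ᵥ (S ^ q *ᵥ y)) + b * ((q + 1) * b) ^ q := by
  have hnn := hp_psd_pow_nonneg S hS y
  rcases Nat.eq_zero_or_pos q with rfl | hq
  · have := hnn 0
    simp only [pow_zero, one_mulVec, mul_one] at *
    have := mul_nonneg (Real.exp_pos 1).le this
    linarith
  have hq' : (0 : ℝ) < q := by exact_mod_cast hq
  by_cases hc : y ⬝ᵥ (S ^ q *ᵥ y) ≤ b * (q * b) ^ q
  · have h := hp_step1 S y b (q * b) (by positivity) hb q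
      (fun j hj => hp_interp S hS y b _ (by positivity) q hq hy hc j hj) hnn q 0 (by omega)
    simp only [pow_zero, one_mulVec, mul_one] at h
    have h2 : (q : ℝ) * b + b = (q + 1) * b := by ring
    rw [h2] at h
    have := mul_nonneg (Real.exp_pos 1).le (hnn q)
    linarith
  · push Not at hc
    set a := y ⬝ᵥ (S ^ q *ᵥ y) with ha
    have ha0 : 0 < a := lt_of_le_of_lt (by positivity) hc
    set A := (a / b) ^ ((q : ℝ)⁻¹) with hA
    have hA0 : 0 < A := Real.rpow_pos_of_pos (by positivity) _
    have hAq : A ^ q = a / b := by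
      rw [hA]; exact Real.rpow_inv_natCast_pow (by positivity) hq.ne'
    have hAb : b * A ^ q = a := by rw [hAq]; field_simp
    have h := hp_step1 S y b A hA0 hb q
      (fun j hj => hp_interp S hS y b _ hA0 q hq hy (by rw [hAb]) j hj) hnn q 0 (by omega)
    simp only [pow_zero, one_mulVec, mul_one] at h
    have hqb : q * b ≤ A := by
      by_contra hcon
      push Not at hcon
      have : A ^ q ≤ (q * b) ^ q := pow_le_pow_left₀ hA0.le hcon.le q
      rw [← hAb] at hc
      have := mul_le_mul_of_nonneg_left this hb.le
      linarith
    have h5 : A + b ≤ A * Real.exp ((q : ℝ)⁻¹) := by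
      have := Real.add_one_le_exp ((q : ℝ)⁻¹)
      have h6 : b ≤ A * (q : ℝ)⁻¹ := by
        rw [← div_eq_mul_inv, le_div_iff₀ hq']; linarith
      nlinarith
    have h7 : (A + b) ^ q ≤ A ^ q * Real.exp 1 := by
      calc (A + b) ^ q ≤ (A * Real.exp ((q : ℝ)⁻¹)) ^ q := pow_le_pow_left₀ (by positivity) h5 q
        _ = _ := by
          rw [mul_pow, ← Real.exp_nat_mul]
          congr 2
          field_simp
    have h8 : b * (A + b) ^ q ≤ Real.exp 1 * a := by
      calc b * (A + b) ^ q ≤ b * (A ^ q * Real.exp 1) := by gcongr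
        _ = Real.exp 1 * (b * A ^ q) := by ring
        _ = _ := by rw [hAb]
    have : 0 ≤ b * ((q + 1) * b) ^ q := by positivity
    linarith

open scoped MatrixOrder Matrix.Norms.L2Operator in
lemma hp_psd_sq (P : Matrix κ κ ℝ) (hP : P.PosSemidef) : ∃ B : Matrix κ κ ℝ, P = Bᴴ * B := by
  obtain ⟨B, hB⟩ := CStarAlgebra.nonneg_iff_eq_star_mul_self.mp hP.nonneg
  exact ⟨B, hB⟩

lemma hp_psd_trace (P : Matrix κ κ ℝ) (hP : P.PosSemidef) (v : κ → ℝ) :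
    v ⬝ᵥ (P *ᵥ v) ≤ (v ⬝ᵥ v) * P.trace := by
  obtain ⟨B, rfl⟩ := hp_psd_sq P hP
  have e1 : v ⬝ᵥ ((Bᴴ * B) *ᵥ v) = ∑ i, (∑ j, B i j * v j) ^ 2 := by
    rw [← mulVec_mulVec, dotProduct_mulVec, conjTranspose_eq_transpose_of_trivial,
      vecMul_transpose]
    simp [dotProduct, mulVec, sq]
  have e2 : (Bᴴ * B).trace = ∑ i, ∑ j, B i j ^ 2 := by
    rw [Finset.sum_comm]
    simp [trace, Matrix.mul_apply, sq]
  rw [e1, e2, Finset.mul_sum]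
  refine Finset.sum_le_sum fun i _ => ?_
  have := Finset.sum_mul_sq_le_sq_mul_sq Finset.univ (B i) v
  simp only [dotProduct, ← sq]
  linarith

lemma hp_cov_trace (P : Matrix κ κ ℝ) (hP : P.PosSemidef) (Cv : κ → κ → ℝ) (Q : ℝ)
    (h : ∀ v : κ → ℝ, ∑ a, ∑ b, v a * v b * Cv a b ≤ Q * ∑ a, v a ^ 2) :
    ∑ a, ∑ b, P a b * Cv a b ≤ Q * P.trace := by
  obtain ⟨B, rfl⟩ := hp_psd_sq P hP
  have e2 : (Bᴴ * B).trace = ∑ i, ∑ j, B i j ^ 2 := by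
    rw [Finset.sum_comm]
    simp [trace, Matrix.mul_apply, sq]
  have e1 : ∑ a, ∑ b, (Bᴴ * B) a b * Cv a b = ∑ i, ∑ a, ∑ b, B i a * B i b * Cv a b := by
    simp only [Matrix.mul_apply, Finset.sum_mul, conjTranspose_apply, star_trivial]
    rw [Finset.sum_comm' (t' := Finset.univ) (s' := fun _ => Finset.univ) (by simp)]
    conv_rhs => rw [Finset.sum_comm]
    conv_rhs => enter [2, a]; rw [Finset.sum_comm]
    rw [Finset.sum_comm]
  rw [e1, e2, Finset.mul_sum]
  exact Finset.sum_le_sum fun i _ => h (B i)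

end MomentLemma

section MomentProb

open Matrix

/-- Bounded measurable real functions. -/
def HpBM {Ω : Type*} [MeasurableSpace Ω] (f : Ω → ℝ) : Prop :=
  Measurable f ∧ ∃ C, ∀ ω, |f ω| ≤ C

namespace HpBM

variable {Ω : Type*} [MeasurableSpace Ω]

lemma const (c : ℝ) : HpBM (fun _ : Ω => c) := ⟨measurable_const, |c|, fun _ => le_rfl⟩

lemma add {f g : Ω → ℝ} (hf : HpBM f) (hg : HpBM g) : HpBM (fun ω => f ω + g ω) := by
  obtain ⟨h1, C, hC⟩ := hf
  obtain ⟨h2, D, hD⟩ := hg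
  exact ⟨h1.add h2, C + D, fun ω => (abs_add_le _ _).trans (add_le_add (hC ω) (hD ω))⟩

lemma mul {f g : Ω → ℝ} (hf : HpBM f) (hg : HpBM g) : HpBM (fun ω => f ω * g ω) := by
  obtain ⟨h1, C, hC⟩ := hf
  obtain ⟨h2, D, hD⟩ := hg
  refine ⟨h1.mul h2, C * D, fun ω => ?_⟩
  rw [abs_mul]
  exact mul_le_mul (hC ω) (hD ω) (abs_nonneg _) ((abs_nonneg _).trans (hC ω))

lemma sum {ι : Type*} (s : Finset ι) {f : ι → Ω → ℝ} (hf : ∀ i ∈ s, HpBM (f i)) :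
    HpBM (fun ω => ∑ i ∈ s, f i ω) := by
  classical
  induction s using Finset.induction_on with
  | empty => simpa using const 0
  | insert a s ha ih =>
    simp only [Finset.sum_insert ha]
    exact (hf a (Finset.mem_insert_self _ _)).add
      (ih fun i hi => hf i (Finset.mem_insert_of_mem hi))

lemma integrable {f : Ω → ℝ} (hf : HpBM f) (P : Measure Ω) [IsFiniteMeasure P] :
    Integrable f P := by
  obtain ⟨h1, C, hC⟩ := hf
  exact Integrable.of_bound h1.aestronglyMeasurable C (Filter.Eventually.of_forall hC)

end HpBM

variable {κ : Type*} [Fintype κ] [DecidableEq κ]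

lemma hp_bm_pow {Ω : Type*} [MeasurableSpace Ω] (M : Ω → Matrix κ κ ℝ)
    (hM : ∀ a b, HpBM (fun ω => M ω a b)) (m : ℕ) :
    ∀ a b, HpBM (fun ω => (M ω ^ m) a b) := by
  induction m with
  | zero => intro a b; simpa using HpBM.const _
  | succ n ih =>
    intro a b
    simp only [pow_succ, Matrix.mul_apply]
    exact HpBM.sum _ fun i _ => (ih a i).mul (hM i b)

lemma hp_meas_pow {Ω : Type*} [MeasurableSpace Ω] (M : Ω → Matrix κ κ ℝ)
    (hM : ∀ a b, Measurable (fun ω => M ω a b)) (m : ℕ) :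
    ∀ a b, Measurable (fun ω => (M ω ^ m) a b) := by
  induction m with
  | zero => intro a b; simp
  | succ n ih =>
    intro a b
    simp only [pow_succ, Matrix.mul_apply]
    exact Finset.measurable_sum _ fun i _ => (ih a i).mul (hM i b)

/-- Sum of rank one matrices. -/
def hpS {ι : Type*} (s : Finset ι) (y : ι → κ → ℝ) : Matrix κ κ ℝ :=
  ∑ i ∈ s, vecMulVec (y i) (y i)

lemma hpS_apply {ι : Type*} (s : Finset ι) (y : ι → κ → ℝ) (a b : κ) :
    hpS s y a b = ∑ i ∈ s, y i a * y i b := by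
  simp [hpS, Matrix.sum_apply, vecMulVec_apply]

lemma hpS_psd {ι : Type*} (s : Finset ι) (y : ι → κ → ℝ) : (hpS s y).PosSemidef := by
  refine Matrix.posSemidef_sum s fun i _ => ?_
  simpa using Matrix.posSemidef_vecMulVec_self_star (y i)

lemma hp_trace_succ {ι : Type*} (s : Finset ι) (y : ι → κ → ℝ) (m : ℕ) :
    ((hpS s y) ^ (m + 1)).trace = ∑ i ∈ s, y i ⬝ᵥ ((hpS s y) ^ m *ᵥ y i) := by
  rw [pow_succ]
  have e : hpS s y ^ m * hpS s y = ∑ i ∈ s, hpS s y ^ m * vecMulVec (y i) (y i) := by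
    rw [← Matrix.mul_sum]; rfl
  rw [e, Matrix.trace_sum]
  refine Finset.sum_congr rfl fun i _ => ?_
  rw [mul_vecMulVec, trace_vecMulVec, dotProduct_comm]

variable {Ω : Type*} [MeasurableSpace Ω] {ι : Type*} [Fintype ι] [DecidableEq ι]

lemma hp_quad_expand (M : Matrix κ κ ℝ) (v : κ → ℝ) :
    v ⬝ᵥ (M *ᵥ v) = ∑ a, ∑ b, M a b * (v a * v b) := by
  simp only [dotProduct, mulVec, Finset.mul_sum]
  exact Finset.sum_congr rfl fun a _ => Finset.sum_congr rfl fun b _ => by ring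

lemma hp_bm_entries (Y : ι → Ω → κ → ℝ) (hY : ∀ i, Measurable (Y i)) (b : ℝ)
    (hb : ∀ i ω, ∑ j, (Y i ω j) ^ 2 ≤ b) (i : ι) (j : κ) : HpBM (fun ω => Y i ω j) := by
  refine ⟨(measurable_pi_apply j).comp (hY i), Real.sqrt b, fun ω => ?_⟩
  apply Real.abs_le_sqrt
  exact (Finset.single_le_sum (f := fun j => (Y i ω j) ^ 2) (fun _ _ => sq_nonneg _)
    (Finset.mem_univ j)).trans (hb i ω)

lemma hp_bm_S (Y : ι → Ω → κ → ℝ) (hY : ∀ i j, HpBM (fun ω => Y i ω j)) (s : Finset ι) (m : ℕ)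
    (a c : κ) : HpBM (fun ω => ((hpS s (fun i => Y i ω)) ^ m) a c) := by
  apply hp_bm_pow
  intro a c
  simp only [hpS_apply]
  exact HpBM.sum _ fun i _ => (hY i a).mul (hY i c)

lemma hp_exp_quad (P : Measure Ω) [IsProbabilityMeasure P] (Y : ι → Ω → κ → ℝ)
    (hY : ∀ i, Measurable (Y i)) (hind : iIndepFun Y P) (b Q : ℝ)
    (hb : ∀ i ω, ∑ j, (Y i ω j) ^ 2 ≤ b)
    (hQ : ∀ i (v : κ → ℝ), ∫ ω, (∑ j, v j * Y i ω j) ^ 2 ∂P ≤ Q * ∑ j, v j ^ 2)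
    (s : Finset ι) (i : ι) (hi : i ∉ s) (m : ℕ) :
    ∫ ω, Y i ω ⬝ᵥ ((hpS s (fun i => Y i ω)) ^ m *ᵥ Y i ω) ∂P ≤
      Q * ∫ ω, ((hpS s (fun i => Y i ω)) ^ m).trace ∂P := by
  have hBM := hp_bm_entries Y hY b hb
  have hBS := hp_bm_S Y hBM s m
  set Pm : Matrix κ κ ℝ := Matrix.of fun a c => ∫ ω, ((hpS s (fun i => Y i ω)) ^ m) a c ∂P with hPm
  have htr : ∫ ω, ((hpS s (fun i => Y i ω)) ^ m).trace ∂P = Pm.trace := by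
    simp only [trace, diag_apply]
    rw [integral_finsetSum _ fun a _ => (hBS a a).integrable P]
    rfl
  have hpsd : Pm.PosSemidef := by
    refine .of_dotProduct_mulVec_nonneg ?_ fun v => ?_
    · ext a c
      simp only [conjTranspose_apply, star_trivial, hPm, of_apply]
      congr 1
      ext ω
      have h1 : ((hpS s (fun i => Y i ω)) ^ m).IsHermitian :=
        ((hpS_psd s (fun i => Y i ω)).1).pow m
      simpa using congrFun (congrFun h1 a) c
    · have : star v ⬝ᵥ Pm *ᵥ v = ∫ ω, v ⬝ᵥ ((hpS s (fun i => Y i ω)) ^ m *ᵥ v) ∂P := by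
        simp only [star_trivial, hp_quad_expand]
        rw [integral_finsetSum _ fun a _ => (HpBM.sum _ fun c _ =>
          (hBS a c).mul (HpBM.const _)).integrable P]
        refine Finset.sum_congr rfl fun a _ => ?_
        rw [integral_finsetSum _ fun c _ => ((hBS a c).mul (HpBM.const _)).integrable P]
        refine Finset.sum_congr rfl fun c _ => ?_
        rw [integral_mul_const]
        rfl
      rw [this]
      exact integral_nonneg fun ω => hp_psd_pow_nonneg _ (hpS_psd _ _) v m
  have hind2 := hind.indepFun_finset s {i} (Finset.disjoint_singleton_right.2 hi) hY
  have hprod : ∀ a c, ∫ ω, ((hpS s (fun i => Y i ω)) ^ m) a c * (Y i ω a * Y i ω c) ∂P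
      = Pm a c * ∫ ω, Y i ω a * Y i ω c ∂P := by
    intro a c
    have hF : Measurable (fun z : s → κ → ℝ => ((hpS Finset.univ z) ^ m) a c) := by
      apply hp_meas_pow
      intro a c
      simp only [hpS_apply]
      fun_prop
    have hG : Measurable (fun z : ({i} : Finset ι) → κ → ℝ =>
        z ⟨i, Finset.mem_singleton_self i⟩ a * z ⟨i, Finset.mem_singleton_self i⟩ c) := by
      fun_prop
    have h3 := hind2.comp hF hG
    have e1 : ((fun z : s → κ → ℝ => ((hpS Finset.univ z) ^ m) a c) ∘
        fun ω (j : s) => Y j ω) = fun ω => ((hpS s (fun i => Y i ω)) ^ m) a c := by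
      funext ω
      simp only [Function.comp, hpS]
      rw [Finset.sum_coe_sort s (fun j => vecMulVec (Y j ω) (Y j ω))]
    have h4 := h3.integral_fun_mul_eq_mul_integral (by
      rw [e1]; exact (hBS a c).1.aestronglyMeasurable)
      ((hBM i a).mul (hBM i c)).1.aestronglyMeasurable
    rw [e1] at h4
    exact h4
  have e : ∫ ω, Y i ω ⬝ᵥ ((hpS s (fun i => Y i ω)) ^ m *ᵥ Y i ω) ∂P =
      ∑ a, ∑ c, Pm a c * ∫ ω, Y i ω a * Y i ω c ∂P := by
    simp only [hp_quad_expand]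
    rw [integral_finsetSum _ fun a _ => (HpBM.sum _ fun c _ =>
      (hBS a c).mul ((hBM i a).mul (hBM i c))).integrable P]
    refine Finset.sum_congr rfl fun a _ => ?_
    rw [integral_finsetSum _ fun c _ =>
      ((hBS a c).mul ((hBM i a).mul (hBM i c))).integrable P]
    exact Finset.sum_congr rfl fun c _ => hprod a c
  rw [e, htr]
  apply hp_cov_trace _ hpsd
  intro v
  refine le_trans (le_of_eq ?_) (hQ i v)
  have : ∀ ω, (∑ j, v j * Y i ω j) ^ 2 = ∑ a, ∑ c, v a * v c * (Y i ω a * Y i ω c) := by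
    intro ω
    rw [sq, Finset.sum_mul_sum]
    exact Finset.sum_congr rfl fun a _ => Finset.sum_congr rfl fun b _ => by ring
  simp only [this]
  rw [integral_finsetSum _ fun a _ => (HpBM.sum _ fun c _ =>
      (HpBM.const _).mul ((hBM i a).mul (hBM i c))).integrable P]
  refine Finset.sum_congr rfl fun a _ => ?_
  rw [integral_finsetSum _ fun c _ =>
      ((HpBM.const _).mul ((hBM i a).mul (hBM i c))).integrable P]
  exact Finset.sum_congr rfl fun c _ => (integral_const_mul _ _).symm

lemma hp_moment (P : Measure Ω) [IsProbabilityMeasure P] (Y : ι → Ω → κ → ℝ)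
    (hY : ∀ i, Measurable (Y i)) (hind : iIndepFun Y P) (b Q : ℝ) (hb0 : 0 < b) (hQ0 : 0 ≤ Q)
    (hb : ∀ i ω, ∑ j, (Y i ω j) ^ 2 ≤ b)
    (hQ : ∀ i (v : κ → ℝ), ∫ ω, (∑ j, v j * Y i ω j) ^ 2 ∂P ≤ Q * ∑ j, v j ^ 2)
    (n : ℕ) (L : ℝ) (hL1 : Real.exp 1 * Fintype.card ι * Q ≤ L) (hL2 : n * b ≤ L) :
    ∀ m ≤ n, ∀ s : Finset ι, ∫ ω, ((hpS s (fun i => Y i ω)) ^ m).trace ∂P ≤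
      (Fintype.card κ + Fintype.card ι * m) * L ^ m := by
  have hL0 : 0 ≤ L := le_trans (by positivity) hL1
  have hBM := hp_bm_entries Y hY b hb
  intro m
  induction m with
  | zero => intro _ s; simp
  | succ m ih =>
    intro hm s
    have hBMquad : ∀ (s t : Finset ι) i, HpBM fun ω =>
        Y i ω ⬝ᵥ ((hpS t (fun i => Y i ω)) ^ m *ᵥ Y i ω) := by
      intro s t i
      simp only [hp_quad_expand]
      exact HpBM.sum _ fun a _ => HpBM.sum _ fun c _ =>
        (hp_bm_S Y hBM t m a c).mul ((hBM i a).mul (hBM i c))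
    simp only [hp_trace_succ]
    rw [integral_finsetSum _ fun i _ => (hBMquad s s i).integrable P]
    have hbL : (m + 1) * b ≤ L := by
      refine le_trans ?_ hL2
      gcongr
      exact_mod_cast hm
    have hbL' : b ≤ L := by
      refine le_trans ?_ hbL
      nlinarith [Nat.cast_nonneg (α := ℝ) m]
    have hterm : ∀ i ∈ s, ∫ ω, Y i ω ⬝ᵥ ((hpS s (fun i => Y i ω)) ^ m *ᵥ Y i ω) ∂P ≤
        Real.exp 1 * (Q * ((Fintype.card κ + Fintype.card ι * m) * L ^ m)) + L ^ (m + 1) := by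
      intro i hi
      have h1 : ∀ ω, Y i ω ⬝ᵥ ((hpS s (fun i => Y i ω)) ^ m *ᵥ Y i ω) ≤
          Real.exp 1 * (Y i ω ⬝ᵥ ((hpS (s.erase i) (fun i => Y i ω)) ^ m *ᵥ Y i ω))
          + b * ((m + 1) * b) ^ m := by
        intro ω
        have hs : hpS s (fun i => Y i ω) =
            hpS (s.erase i) (fun i => Y i ω) + vecMulVec (Y i ω) (Y i ω) := by
          rw [hpS, hpS, Finset.sum_erase_add s (fun j => vecMulVec (Y j ω) (Y j ω)) hi]
        rw [hs]
        refine hp_step2 _ (hpS_psd _ _) _ b hb0 ?_ m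
        simpa [dotProduct, sq] using hb i ω
      have h2 := integral_mono ((hBMquad s s i).integrable P)
        ((((HpBM.const _).mul (hBMquad s (s.erase i) i)).add (HpBM.const _)).integrable P) h1
      refine h2.trans ?_
      rw [integral_add (((HpBM.const _).mul (hBMquad s (s.erase i) i)).integrable P)
        ((HpBM.const _).integrable P), integral_const_mul]
      simp only [integral_const, probReal_univ, one_smul]
      have h3 := hp_exp_quad P Y hY hind b Q hb hQ (s.erase i) i (Finset.notMem_erase i s) m
      have h4 := ih (by omega) (s.erase i)
      have h5 : b * ((m + 1) * b) ^ m ≤ L ^ (m + 1) := by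
        rw [pow_succ']
        gcongr
      have h6 := mul_le_mul_of_nonneg_left h4 hQ0
      have h7 := mul_le_mul_of_nonneg_left (h3.trans h6) (Real.exp_pos 1).le
      linarith
    refine (Finset.sum_le_sum hterm).trans ?_
    rw [Finset.sum_const, nsmul_eq_mul]
    have hcard : (s.card : ℝ) ≤ Fintype.card ι := by exact_mod_cast Finset.card_le_univ s
    set X : ℝ := (Fintype.card κ + Fintype.card ι * m) * L ^ m with hX
    have hX0 : 0 ≤ X := by positivity
    calc (s.card : ℝ) * (Real.exp 1 * (Q * X) + L ^ (m + 1))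
        ≤ Fintype.card ι * (Real.exp 1 * (Q * X) + L ^ (m + 1)) := by
          gcongr
      _ = (Real.exp 1 * Fintype.card ι * Q) * X + Fintype.card ι * L ^ (m + 1) := by ring
      _ ≤ L * X + Fintype.card ι * L ^ (m + 1) := by gcongr
      _ = _ := by rw [hX]; push_cast; ring

lemma hp_chernoff (P : Measure Ω) [IsProbabilityMeasure P] (Y : ι → Ω → κ → ℝ)
    (hY : ∀ i, Measurable (Y i)) (hind : iIndepFun Y P) (b Q : ℝ) (hb0 : 0 < b) (hQ0 : 0 ≤ Q)
    (hb : ∀ i ω, ∑ j, (Y i ω j) ^ 2 ≤ b)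
    (hQ : ∀ i (v : κ → ℝ), ∫ ω, (∑ j, v j * Y i ω j) ^ 2 ∂P ≤ Q * ∑ j, v j ^ 2)
    (n : ℕ) (hn : 0 < n) (L : ℝ) (hL1 : Real.exp 1 * Fintype.card ι * Q ≤ L) (hL2 : n * b ≤ L) :
    P {ω | ¬ ∀ v : κ → ℝ, ∑ i, (∑ j, Y i ω j * v j) ^ 2 ≤ Real.exp 1 * L * ∑ j, v j ^ 2} ≤
      ENNReal.ofReal ((Fintype.card κ + Fintype.card ι * n) * Real.exp (-n)) := by
  have hn' : (0 : ℝ) < n := by exact_mod_cast hn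
  have hL0 : 0 < L := lt_of_lt_of_le (by positivity) hL2
  have hBM := hp_bm_entries Y hY b hb
  have hBT : HpBM fun ω => ((hpS Finset.univ (fun i => Y i ω)) ^ n).trace := by
    simp only [trace, diag_apply]
    exact HpBM.sum _ fun a _ => hp_bm_S Y hBM _ n a a
  have hnn : ∀ ω, 0 ≤ ((hpS Finset.univ (fun i => Y i ω)) ^ n).trace := fun ω =>
    ((hpS_psd _ _).pow n).trace_nonneg
  have hM := hp_moment P Y hY hind b Q hb0 hQ0 hb hQ n L hL1 hL2 n le_rfl Finset.univ
  have hsub : {ω | ¬ ∀ v : κ → ℝ, ∑ i, (∑ j, Y i ω j * v j) ^ 2 ≤ Real.exp 1 * L * ∑ j, v j ^ 2}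
      ⊆ {ω | (Real.exp 1 * L) ^ n ≤ ((hpS Finset.univ (fun i => Y i ω)) ^ n).trace} := by
    intro ω hω
    by_contra hcon
    apply hω
    intro v
    simp only [Set.mem_ofPred_eq, not_le] at hcon
    have h1 := hp_psd_trace _ ((hpS_psd Finset.univ (fun i => Y i ω)).pow n) v
    have hv : 0 ≤ v ⬝ᵥ v := by
      simp only [dotProduct]; exact Finset.sum_nonneg fun _ _ => mul_self_nonneg _
    have h2 := hp_interp _ (hpS_psd Finset.univ (fun i => Y i ω)) v (v ⬝ᵥ v) (Real.exp 1 * L)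
      (by positivity) n hn le_rfl (h1.trans (mul_le_mul_of_nonneg_left hcon.le hv)) 1 hn
    have e : v ⬝ᵥ (hpS Finset.univ (fun i => Y i ω) ^ 1 *ᵥ v) =
        ∑ i, (∑ j, Y i ω j * v j) ^ 2 := by
      rw [pow_one, hpS, sum_mulVec, dotProduct_sum]
      refine Finset.sum_congr rfl fun i _ => ?_
      rw [vecMulVec_mulVec, op_smul_eq_smul, dotProduct_smul, smul_eq_mul, dotProduct_comm v, sq]
      rfl
    rw [e] at h2
    have e2 : v ⬝ᵥ v = ∑ j, v j ^ 2 := by simp [dotProduct, sq]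
    rw [e2] at h2
    linarith
  refine (measure_mono hsub).trans ?_
  have hmk := mul_meas_ge_le_integral_of_nonneg (Filter.Eventually.of_forall hnn)
    (hBT.integrable P) ((Real.exp 1 * L) ^ n)
  rw [← ofReal_measureReal]
  apply ENNReal.ofReal_le_ofReal
  have h3 := hmk.trans hM
  have h4 : (Real.exp 1 * L) ^ n = Real.exp n * L ^ n := by
    rw [mul_pow, ← Real.exp_nat_mul, mul_one]
  rw [h4] at h3
  rw [Real.exp_neg, ← div_eq_mul_inv, le_div_iff₀ (Real.exp_pos _)]
  have hLn : 0 < L ^ n := by positivity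
  rw [← h4] at h3
  have h5 : (L ^ n) * (P.real {ω | (Real.exp 1 * L) ^ n ≤
    ((hpS Finset.univ (fun i => Y i ω)) ^ n).trace} * Real.exp n) ≤
      (L ^ n) * (Fintype.card κ + Fintype.card ι * n) := by
    calc _ = (Real.exp 1 * L) ^ n * P.real {ω | (Real.exp 1 * L) ^ n ≤
      ((hpS Finset.univ (fun i => Y i ω)) ^ n).trace} := by rw [h4]; ring
      _ ≤ _ := h3
      _ = _ := by ring
  exact le_of_mul_le_mul_left h5 hLn

end MomentProb

section GaussianFacts

open Real

instance hp_prob_stdG (ι : Type*) [Fintype ι] : IsProbabilityMeasure (stdG ι) := by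
  unfold stdG; infer_instance

variable {ι : Type*} [Fintype ι]

lemma hp_meas_dotp (u : ι → ℝ) : Measurable (fun g : ι → ℝ => dotp g u) := by
  unfold dotp; fun_prop

lemma hp_law (u : ι → ℝ) :
    (stdG ι).map (fun g => dotp g u) = gaussianReal 0 (Real.toNNReal (∑ i, u i ^ 2)) := by
  have : IsProbabilityMeasure ((stdG ι).map (fun g => dotp g u)) :=
    Measure.isProbabilityMeasure_map (hp_meas_dotp u).aemeasurable
  refine Measure.ext_of_charFun ?_
  ext t
  rw [charFun_gaussianReal, charFun_apply_real, integral_map (hp_meas_dotp u).aemeasurable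
    (by fun_prop)]
  have e : ∀ g : ι → ℝ, Complex.exp (t * (dotp g u : ℝ) * Complex.I) =
      ∏ i, Complex.exp (((t * u i : ℝ) : ℂ) * (g i : ℝ) * Complex.I) := by
    intro g
    rw [← Complex.exp_sum]
    congr 1
    simp only [dotp]
    push_cast
    rw [Finset.mul_sum, Finset.sum_mul]
    exact Finset.sum_congr rfl fun i _ => by ring
  simp only [e]
  unfold stdG
  rw [integral_fintype_prod_eq_prod (μ := fun _ : ι => gaussianReal 0 1) (𝕜 := ℂ)
    (fun i (x : ℝ) => Complex.exp (((t * u i : ℝ) : ℂ) * (x : ℝ) * Complex.I))]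
  have e2 : ∀ i, ∫ x : ℝ, Complex.exp (((t * u i : ℝ) : ℂ) * (x : ℝ) * Complex.I)
      ∂(gaussianReal 0 1) = Complex.exp (-((t * u i : ℝ) : ℂ) ^ 2 / 2) := by
    intro i
    rw [← charFun_apply_real, charFun_gaussianReal]
    congr 1
    simp
    ring
  simp only [e2]
  rw [← Complex.exp_sum]
  congr 1
  have : ((Real.toNNReal (∑ i, u i ^ 2) : NNReal) : ℂ) = ((∑ i, u i ^ 2 : ℝ) : ℂ) := by
    have h : ((Real.toNNReal (∑ i, u i ^ 2) : NNReal) : ℝ) = ∑ i, u i ^ 2 :=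
      Real.coe_toNNReal _ (Finset.sum_nonneg fun _ _ => sq_nonneg _)
    exact_mod_cast congrArg (fun x : ℝ => (x : ℂ)) h
  rw [this]
  push_cast
  rw [Finset.sum_mul, Finset.sum_div, mul_zero, zero_mul, zero_sub, ← Finset.sum_neg_distrib]
  exact Finset.sum_congr rfl fun i _ => by ring

lemma hp_gauss_int_pow (v : NNReal) (n : ℕ) : Integrable (fun x : ℝ => x ^ n) (gaussianReal 0 v) := by
  have h := (memLp_id_gaussianReal (μ := 0) (v := v) n)
  have := h.integrable_norm_pow'
  simp only [id] at this
  refine this.mono' (by fun_prop) (Filter.Eventually.of_forall fun x => ?_)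
  simp

lemma hp_int_pow (u : ι → ℝ) (n : ℕ) : Integrable (fun g => dotp g u ^ n) (stdG ι) := by
  have h := hp_gauss_int_pow (Real.toNNReal (∑ i, u i ^ 2)) n
  rw [← hp_law u] at h
  exact h.comp_measurable (hp_meas_dotp u)

lemma hp_stein (n : ℕ) : ∫ x, x ^ (n + 2) ∂(gaussianReal 0 1) =
    (n + 1) * ∫ x, x ^ n ∂(gaussianReal 0 1) := by
  rw [integral_gaussianReal_eq_integral_smul one_ne_zero,
    integral_gaussianReal_eq_integral_smul one_ne_zero]
  have hI : ∀ k : ℕ, Integrable (fun x : ℝ => x ^ k * gaussianPDFReal 0 1 x) := by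
    intro k
    have h := integrable_rpow_mul_exp_neg_mul_sq (b := 1 / 2) (by norm_num) (s := k)
      (by have := Nat.cast_nonneg (α := ℝ) k; linarith)
    have := h.mul_const ((√(2 * π * (1 : NNReal)))⁻¹)
    refine this.congr (Filter.Eventually.of_forall fun x => ?_)
    simp only [gaussianPDFReal, Real.rpow_natCast, sub_zero, NNReal.coe_one]
    ring_nf
  have hd : ∀ x : ℝ, HasDerivAt (gaussianPDFReal 0 1) (-x * gaussianPDFReal 0 1 x) x := by
    intro x
    unfold gaussianPDFReal
    have h1 : HasDerivAt (fun x : ℝ => -(x - 0) ^ 2 / (2 * ((1 : NNReal) : ℝ))) (-x) x := by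
      have := (((hasDerivAt_id x).sub_const 0).pow 2).neg.div_const (2 * ((1 : NNReal) : ℝ))
      refine this.congr_deriv ?_
      simp
      try ring
    refine (h1.exp.const_mul ((√(2 * π * ((1 : NNReal) : ℝ)))⁻¹)).congr_deriv ?_
    try ring
  have h := integral_mul_deriv_eq_deriv_mul_of_integrable (u := fun x : ℝ => x ^ (n + 1))
    (v := gaussianPDFReal 0 1) (u' := fun x => (n + 1 : ℝ) * x ^ n)
    (v' := fun x => -x * gaussianPDFReal 0 1 x)
    (fun x _ => by simpa using hasDerivAt_pow (n + 1) x) (fun x _ => hd x)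
    (by
      refine (hI (n + 2)).neg.congr (Filter.Eventually.of_forall fun x => ?_)
      simp only [Pi.neg_apply, Pi.mul_apply]; ring)
    (by
      refine ((hI n).const_mul (n + 1 : ℝ)).congr (Filter.Eventually.of_forall fun x => ?_)
      simp only [Pi.mul_apply]; ring)
    (hI (n + 1))
  have e1 : ∫ x : ℝ, x ^ (n + 1) * (-x * gaussianPDFReal 0 1 x) =
      - ∫ x : ℝ, gaussianPDFReal 0 1 x • x ^ (n + 2) := by
    rw [← integral_neg]
    congr 1; ext x; simp only [smul_eq_mul]; ring
  have e2 : ∫ x : ℝ, (n + 1 : ℝ) * x ^ n * gaussianPDFReal 0 1 x =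
      (n + 1) * ∫ x : ℝ, gaussianPDFReal 0 1 x • x ^ n := by
    rw [← integral_const_mul]
    congr 1; ext x; simp only [smul_eq_mul]; ring
  rw [e1, e2] at h
  linarith

lemma hp_gm : (∫ x, x ^ 2 ∂(gaussianReal 0 1) = 1) ∧ (∫ x, x ^ 4 ∂(gaussianReal 0 1) = 3) ∧
    (∫ x, x ^ 6 ∂(gaussianReal 0 1) = 15) ∧ (∫ x, x ^ 8 ∂(gaussianReal 0 1) = 105) := by
  have h0 := hp_stein 0
  have h2 := hp_stein 2
  have h4 := hp_stein 4
  have h6 := hp_stein 6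
  simp only [zero_add, pow_zero, integral_const, probReal_univ, smul_eq_mul, mul_one,
    Nat.cast_zero] at h0
  norm_num at h2 h4 h6
  rw [h0] at h2
  rw [h2] at h4
  rw [h4] at h6
  refine ⟨h0, by rw [h2]; norm_num, by rw [h4]; norm_num, by rw [h6]; norm_num⟩

lemma hp_dotp_moment (u : ι → ℝ) (n : ℕ) :
    ∫ g, dotp g u ^ (2 * n) ∂(stdG ι) =
      (∑ i, u i ^ 2) ^ n * ∫ x, x ^ (2 * n) ∂(gaussianReal 0 1) := by
  have hnn : 0 ≤ ∑ i, u i ^ 2 := Finset.sum_nonneg fun _ _ => sq_nonneg _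
  have h1 : ∫ g, dotp g u ^ (2 * n) ∂(stdG ι) =
      ∫ x, x ^ (2 * n) ∂(gaussianReal 0 (Real.toNNReal (∑ i, u i ^ 2))) := by
    rw [← hp_law u, integral_map (hp_meas_dotp u).aemeasurable (by fun_prop)]
  have h2 := gaussianReal_map_const_mul (μ := 0) (v := 1) (√(∑ i, u i ^ 2))
  have h3 : gaussianReal 0 (Real.toNNReal (∑ i, u i ^ 2)) =
      (gaussianReal 0 1).map (√(∑ i, u i ^ 2) * ·) := by
    rw [h2]
    congr 1
    · simp
    · ext; simp [hnn]
  rw [h1, h3, integral_map (by fun_prop) (by fun_prop), ← integral_const_mul]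
  congr 1; ext x
  rw [mul_pow, pow_mul (√(∑ i, u i ^ 2)), Real.sq_sqrt hnn]

lemma hp_int_pow_mul (u v : ι → ℝ) (a b : ℕ) :
    Integrable (fun g => dotp g u ^ a * dotp g v ^ b) (stdG ι) := by
  refine ((hp_int_pow u (2 * a)).add (hp_int_pow v (2 * b))).mono' ?_
    (Filter.Eventually.of_forall fun g => ?_)
  · exact (((hp_meas_dotp u).pow_const a).mul ((hp_meas_dotp v).pow_const b)).aestronglyMeasurable
  · simp only [Pi.add_apply, pow_mul', Real.norm_eq_abs]
    rw [abs_le]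
    constructor <;> nlinarith [sq_nonneg (dotp g u ^ a - dotp g v ^ b),
      sq_nonneg (dotp g u ^ a + dotp g v ^ b), sq_nonneg (dotp g u ^ a), sq_nonneg (dotp g v ^ b)]

lemma hp_dotp_lin (g u v : ι → ℝ) (α β : ℝ) :
    dotp g (fun i => α * u i + β * v i) = α * dotp g u + β * dotp g v := by
  simp only [dotp, Finset.mul_sum, ← Finset.sum_add_distrib]
  exact Finset.sum_congr rfl fun i _ => by ring

lemma hp_polar (u v : ι → ℝ) (hu : ∑ i, u i ^ 2 = 1) (hv : ∑ i, v i ^ 2 = 1) (α β : ℝ) (n : ℕ) :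
    ∑ k ∈ Finset.range (2 * n + 1), α ^ k * β ^ (2 * n - k) * ((2 * n).choose k : ℝ) *
      ∫ g, dotp g u ^ k * dotp g v ^ (2 * n - k) ∂(stdG ι) =
    (α ^ 2 + 2 * α * β * dotp u v + β ^ 2) ^ n * ∫ x, x ^ (2 * n) ∂(gaussianReal 0 1) := by
  have h := hp_dotp_moment (fun i => α * u i + β * v i) n
  have e : ∑ i, (α * u i + β * v i) ^ 2 = α ^ 2 + 2 * α * β * dotp u v + β ^ 2 := by
    have : ∑ i, (α * u i + β * v i) ^ 2 =
        α ^ 2 * ∑ i, u i ^ 2 + 2 * α * β * dotp u v + β ^ 2 * ∑ i, v i ^ 2 := by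
      simp only [dotp, Finset.mul_sum, ← Finset.sum_add_distrib]
      exact Finset.sum_congr rfl fun i _ => by ring
    rw [this, hu, hv]; ring
  rw [e] at h
  rw [← h]
  simp only [hp_dotp_lin, add_pow]
  rw [integral_finsetSum]
  · refine Finset.sum_congr rfl fun k _ => ?_
    rw [← integral_const_mul]
    congr 1; ext g
    rw [mul_pow, mul_pow]; ring
  · intro k _
    refine ((hp_int_pow_mul u v k (2 * n - k)).const_mul
      (α ^ k * β ^ (2 * n - k) * ((2 * n).choose k : ℝ))).congr
      (Filter.Eventually.of_forall fun g => ?_)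
    simp only [mul_pow]; ring

lemma hp_mixed (u v : ι → ℝ) (hu : ∑ i, u i ^ 2 = 1) (hv : ∑ i, v i ^ 2 = 1) :
    (∫ g, dotp g u * dotp g v ∂(stdG ι) = dotp u v) ∧
    (∫ g, dotp g u ^ 3 * dotp g v ∂(stdG ι) = 3 * dotp u v) ∧
    (∫ g, dotp g u * dotp g v ^ 3 ∂(stdG ι) = 3 * dotp u v) ∧
    (∫ g, dotp g u ^ 3 * dotp g v ^ 3 ∂(stdG ι) = 9 * dotp u v + 6 * dotp u v ^ 3) ∧
    (∫ g, dotp g u ^ 4 * dotp g v ^ 4 ∂(stdG ι) =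
      9 + 72 * dotp u v ^ 2 + 24 * dotp u v ^ 4) ∧
    (∫ g, dotp g u ^ 4 ∂(stdG ι) = 3) := by
  obtain ⟨g2, g4, g6, g8⟩ := hp_gm
  have P := hp_polar u v hu hv
  have c : (Nat.choose 6 3 = 20) ∧ (Nat.choose 6 2 = 15) ∧ (Nat.choose 6 4 = 15) ∧
    (Nat.choose 4 2 = 6) ∧ (Nat.choose 8 2 = 28) ∧ (Nat.choose 8 3 = 56) ∧ (Nat.choose 8 4 = 70)
    ∧ (Nat.choose 8 5 = 56) ∧ (Nat.choose 8 6 = 28) ∧ (Nat.choose 4 3 = 4) ∧ (Nat.choose 6 5 = 6)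
    ∧ (Nat.choose 8 7 = 8):= by decide
  obtain ⟨c1, c2, c3, c4, c5, c6, c7, c8, c9, c10, c11, c12⟩ := c
  have P2 : ∀ α β : ℝ, _ := fun α β => P α β 1
  have P4 : ∀ α β : ℝ, _ := fun α β => P α β 2
  have P6 : ∀ α β : ℝ, _ := fun α β => P α β 3
  have P8 : ∀ α β : ℝ, _ := fun α β => P α β 4
  simp only [Finset.sum_range_succ, Finset.sum_range_zero, zero_add, mul_one, Nat.reduceMul,
    Nat.reduceSub, Nat.reduceAdd, pow_zero, pow_one, one_mul, Nat.choose_zero_right,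
    Nat.choose_self, Nat.choose_one_right, c1, c2, c3, c4, c5, c6, c7, c8, c9, c10, c11, c12, g2,
    g4, g6, g8, Nat.cast_one, Nat.cast_ofNat, tsub_zero, tsub_self] at P2 P4 P6 P8
  set ρ := dotp u v
  refine ⟨?_, ?_, ?_, ?_, ?_, ?_⟩
  · have a1 := P2 1 1
    have a2 := P2 1 (-1)
    norm_num at a1 a2
    linarith
  · have a1 := P4 1 1
    have a2 := P4 1 (-1)
    have a3 := P4 2 1
    have a4 := P4 2 (-1)
    norm_num at a1 a2 a3 a4
    linarith
  · have a1 := P4 1 1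
    have a2 := P4 1 (-1)
    have a3 := P4 2 1
    have a4 := P4 2 (-1)
    norm_num at a1 a2 a3 a4
    linarith
  · have a1 := P6 1 1
    have a2 := P6 1 (-1)
    have a3 := P6 2 1
    have a4 := P6 2 (-1)
    have a5 := P6 1 2
    have a6 := P6 1 (-2)
    norm_num at a1 a2 a3 a4 a5 a6
    linarith
  · have a1 := P8 1 1
    have a2 := P8 1 (-1)
    have a3 := P8 2 1
    have a4 := P8 2 (-1)
    have a5 := P8 1 2
    have a6 := P8 1 (-2)
    have a7 := P8 1 0
    have a8 := P8 0 1
    norm_num at a1 a2 a3 a4 a5 a6 a7 a8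
    linarith
  · have a7 := P4 1 0
    norm_num at a7
    linarith

end GaussianFacts

section GaussianTails

variable {ι : Type*} [Fintype ι]

lemma hp_tail_one (u : ι → ℝ) (hu : ∑ i, u i ^ 2 ≤ 1) (R : ℝ) :
    (stdG ι).real {g | R ≤ dotp g u} ≤ 2 * Real.exp (-R) := by
  have hInt : Integrable (fun g => Real.exp (1 * dotp g u)) (stdG ι) := by
    have h := integrable_exp_mul_gaussianReal (μ := 0) (v := Real.toNNReal (∑ i, u i ^ 2)) 1
    rw [← hp_law u] at h
    exact h.comp_measurable (hp_meas_dotp u)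
  have h := measure_ge_le_exp_mul_mgf (μ := stdG ι) (X := fun g => dotp g u) (t := 1) R
    zero_le_one hInt
  rw [mgf_gaussianReal (hp_law u) 1] at h
  refine h.trans ?_
  have hnn : 0 ≤ ∑ i, u i ^ 2 := Finset.sum_nonneg fun _ _ => sq_nonneg _
  have h2 : Real.exp (0 * 1 + (Real.toNNReal (∑ i, u i ^ 2) : ℝ) * 1 ^ 2 / 2) ≤ 2 := by
    rw [Real.coe_toNNReal _ hnn]
    have : Real.exp (0 * 1 + (∑ i, u i ^ 2) * 1 ^ 2 / 2) ≤ Real.exp (1 / 2) :=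
      Real.exp_le_exp.mpr (by linarith)
    refine this.trans ?_
    have h3 : Real.exp (1 / 2) ^ 2 = Real.exp 1 := by
      rw [← Real.exp_nat_mul]; norm_num
    have := Real.exp_one_lt_d9
    nlinarith [Real.exp_pos (1 / 2 : ℝ)]
  have h4 : Real.exp (-1 * R) = Real.exp (-R) := by ring_nf
  rw [h4]
  nlinarith [Real.exp_pos (-R)]

lemma hp_tail (u : ι → ℝ) (hu : ∑ i, u i ^ 2 ≤ 1) (R : ℝ) :
    stdG ι {g | R < |dotp g u|} ≤ ENNReal.ofReal (4 * Real.exp (-R)) := by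
  have hneg : ∀ g, dotp g (fun i => - u i) = - dotp g u := by
    intro g; simp [dotp]
  have h1 := hp_tail_one u hu R
  have h2 := hp_tail_one (fun i => - u i) (by simpa using hu) R
  have hsub : {g | R < |dotp g u|} ⊆ {g | R ≤ dotp g u} ∪ {g | R ≤ dotp g (fun i => - u i)} := by
    intro g hg
    simp only [Set.mem_ofPred_eq, Set.mem_union, hneg] at *
    rcases lt_abs.mp hg with h | h
    · exact Or.inl h.le
    · exact Or.inr h.le
  have h3 : (stdG ι).real {g | R < |dotp g u|} ≤ 4 * Real.exp (-R) := by
    refine (measureReal_mono hsub).trans ((measureReal_union_le _ _).trans ?_)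
    linarith
  rw [← ofReal_measureReal]
  exact ENNReal.ofReal_le_ofReal h3

lemma hp_chi_real (y : ℝ) (hy : |y| ≤ 1 / 2) : (1 - y)⁻¹ ≤ Real.exp (y + y ^ 2) := by
  rw [abs_le] at hy
  have h1 : 0 < 1 - y := by linarith
  rw [inv_le_iff_one_le_mul₀ h1]
  rcases le_total y 0 with h | h
  · have := Real.add_one_le_exp (y + y ^ 2)
    have h2 : (1 + y + y ^ 2) * (1 - y) ≤ Real.exp (y + y ^ 2) * (1 - y) :=
      mul_le_mul_of_nonneg_right (by linarith) h1.le
    nlinarith [mul_nonneg (neg_nonneg.mpr h) (sq_nonneg y)]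
  · have h0 : 0 ≤ y + y ^ 2 := by positivity
    have := Real.quadratic_le_exp_of_nonneg h0
    have h2 : (1 + (y + y ^ 2) + (y + y ^ 2) ^ 2 / 2) * (1 - y) ≤ Real.exp (y + y ^ 2) * (1 - y) :=
      mul_le_mul_of_nonneg_right (by linarith) h1.le
    refine le_trans ?_ h2
    have h5 : 0 ≤ (1 - y) * (1 + y) ^ 2 - 2 * y := by nlinarith [mul_nonneg h h]
    nlinarith [mul_nonneg (sq_nonneg y) h5]

lemma hp_chi_mgf (l : ℝ) (hl : |l| ≤ 1 / 4) :
    Integrable (fun x : ℝ => Real.exp (l * (x ^ 2 - 1))) (gaussianReal 0 1) ∧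
    ∫ x, Real.exp (l * (x ^ 2 - 1)) ∂(gaussianReal 0 1) ≤ Real.exp (2 * l ^ 2) := by
  have hl' := abs_le.mp hl
  have hb : 0 < 1 / 2 - l := by linarith
  have hI := integrable_exp_neg_mul_sq hb
  have key : ∀ x : ℝ, gaussianPDFReal 0 1 x * Real.exp (l * (x ^ 2 - 1)) =
      ((√(2 * Real.pi))⁻¹ * Real.exp (-l)) * Real.exp (-(1 / 2 - l) * x ^ 2) := by
    intro x
    simp only [gaussianPDFReal, sub_zero, NNReal.coe_one, mul_one]
    rw [mul_assoc, mul_assoc, ← Real.exp_add, ← Real.exp_add]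
    congr 2; ring
  constructor
  · rw [gaussianReal_of_var_ne_zero _ one_ne_zero, integrable_withDensity_iff_integrable_smul']
    · have := hI.const_mul ((√(2 * Real.pi))⁻¹ * Real.exp (-l))
      refine this.congr (Filter.Eventually.of_forall fun x => ?_)
      simp only [smul_eq_mul, toReal_gaussianPDF]
      exact (key x).symm
    · exact measurable_gaussianPDF 0 1
    · exact Filter.Eventually.of_forall fun x => gaussianPDF_lt_top
  · rw [integral_gaussianReal_eq_integral_smul one_ne_zero]
    simp only [smul_eq_mul]
    simp_rw [key]
    rw [integral_const_mul, integral_gaussian]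
    have e : (√(2 * Real.pi))⁻¹ * Real.exp (-l) * √(Real.pi / (1 / 2 - l)) =
        Real.exp (-l) * √((1 - 2 * l)⁻¹) := by
      have : Real.pi / (1 / 2 - l) = (2 * Real.pi) * (1 - 2 * l)⁻¹ := by
        have : 1 - 2 * l ≠ 0 := by linarith
        have := hb.ne'
        field_simp
      rw [this, Real.sqrt_mul (show (0 : ℝ) ≤ 2 * Real.pi by positivity) ((1 - 2 * l)⁻¹)]
      have : √(2 * Real.pi) ≠ 0 := (Real.sqrt_pos.mpr (by positivity)).ne'
      generalize √((1 - 2 * l)⁻¹) = z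
      generalize √(2 * Real.pi) = y at this
      field_simp
    rw [e]
    have h := hp_chi_real (2 * l) (by rw [abs_mul]; norm_num; linarith)
    have h2 : √((1 - 2 * l)⁻¹) ≤ Real.exp (l + 2 * l ^ 2) := by
      rw [Real.sqrt_le_left (Real.exp_pos _).le]
      refine h.trans (le_of_eq ?_)
      rw [← Real.exp_nat_mul]; congr 1; push_cast; ring
    calc _ ≤ Real.exp (-l) * Real.exp (l + 2 * l ^ 2) :=
          mul_le_mul_of_nonneg_left h2 (Real.exp_pos _).le
      _ = _ := by rw [← Real.exp_add]; congr 1; ring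

lemma hp_chi_mgf_sum (l : ℝ) (hl : |l| ≤ 1 / 4) :
    Integrable (fun g : ι → ℝ => Real.exp (l * (∑ i, g i ^ 2 - Fintype.card ι))) (stdG ι) ∧
    ∫ g, Real.exp (l * (∑ i, g i ^ 2 - Fintype.card ι)) ∂(stdG ι) ≤
      Real.exp (2 * l ^ 2 * Fintype.card ι) := by
  obtain ⟨h1, h2⟩ := hp_chi_mgf l hl
  have e : ∀ g : ι → ℝ, Real.exp (l * (∑ i, g i ^ 2 - Fintype.card ι)) =
      ∏ i, Real.exp (l * (g i ^ 2 - 1)) := by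
    intro g
    rw [← Real.exp_sum, ← Finset.mul_sum, Finset.sum_sub_distrib]
    simp
  simp_rw [e]
  constructor
  · exact Integrable.fintype_prod (f := fun _ x => Real.exp (l * (x ^ 2 - 1))) fun _ => h1
  · have := integral_fintype_prod_eq_prod (μ := fun _ : ι => gaussianReal 0 1)
      (fun (_ : ι) (x : ℝ) => Real.exp (l * (x ^ 2 - 1)))
    rw [stdG, this, Finset.prod_const, Finset.card_univ]
    calc _ ≤ Real.exp (2 * l ^ 2) ^ Fintype.card ι :=
          pow_le_pow_left₀ (integral_nonneg fun x => (Real.exp_pos _).le) h2 _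
      _ = _ := by rw [← Real.exp_nat_mul]; congr 1; ring

lemma hp_chi (d : ℕ) (hd : 1 ≤ d) (m : ℝ) :
    stdG (Fin d) {g | 4 * m * √d < |∑ i, g i ^ 2 - d|} ≤
      ENNReal.ofReal (4 * Real.exp (-m)) := by
  have hd1 : (1 : ℝ) ≤ √d := by
    rw [Real.one_le_sqrt]; exact_mod_cast hd
  have hsq : √(d : ℝ) ^ 2 = d := Real.sq_sqrt (Nat.cast_nonneg d)
  set l := 1 / (4 * √d) with hl
  have hl0 : 0 < l := by positivity
  have hl1 : l ≤ 1 / 4 := by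
    rw [hl]; apply one_div_le_one_div_of_le <;> linarith
  have hle : 2 * l ^ 2 * d = 1 / 8 := by
    rw [hl]; field_simp; rw [hsq]; ring
  have he : Real.exp (1 / 8) ≤ 2 := by
    have h3 : Real.exp (1 / 8) ≤ Real.exp (1 / 2) := Real.exp_le_exp.mpr (by norm_num)
    have h4 : Real.exp (1 / 2) ^ 2 = Real.exp 1 := by
      rw [← Real.exp_nat_mul]; norm_num
    have := Real.exp_one_lt_d9
    nlinarith [Real.exp_pos (1 / 2 : ℝ)]
  have hml : l * (4 * m * √d) = m := by rw [hl]; field_simp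
  have hp := hp_chi_mgf_sum (ι := Fin d) l (by rw [abs_of_pos hl0]; exact hl1)
  have hn := hp_chi_mgf_sum (ι := Fin d) (-l) (by rw [abs_neg, abs_of_pos hl0]; exact hl1)
  simp only [Fintype.card_fin] at hp hn
  have h1 := measure_ge_le_exp_mul_mgf (μ := stdG (Fin d)) (X := fun g => ∑ i, g i ^ 2 - (d : ℝ))
    (t := l) (4 * m * √d) hl0.le hp.1
  have h2 := measure_le_le_exp_mul_mgf (μ := stdG (Fin d)) (X := fun g => ∑ i, g i ^ 2 - (d : ℝ))
    (t := -l) (-(4 * m * √d)) (by linarith) hn.1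
  have e1 : Real.exp (-l * (4 * m * √d)) = Real.exp (-m) := by
    congr 1; linarith
  have e2 : Real.exp (- -l * -(4 * m * √d)) = Real.exp (-m) := by
    congr 1; linarith
  rw [e1, mgf] at h1
  rw [e2, mgf] at h2
  have hp2 := hp.2
  have hn2 := hn.2
  rw [neg_sq, hle] at hn2
  rw [hle] at hp2
  have hsub : {g : Fin d → ℝ | 4 * m * √d < |∑ i, g i ^ 2 - d|} ⊆
      {g | 4 * m * √d ≤ ∑ i, g i ^ 2 - (d : ℝ)} ∪ {g | ∑ i, g i ^ 2 - (d : ℝ) ≤ -(4 * m * √d)} := by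
    intro g hg
    simp only [Set.mem_ofPred_eq, Set.mem_union] at *
    rcases lt_abs.mp hg with h | h
    · exact Or.inl h.le
    · exact Or.inr (by linarith)
  have h3 : (stdG (Fin d)).real {g | 4 * m * √d < |∑ i, g i ^ 2 - d|} ≤ 4 * Real.exp (-m) := by
    refine (measureReal_mono hsub).trans ((measureReal_union_le _ _).trans ?_)
    have := mul_le_mul_of_nonneg_left (hp2.trans he) (Real.exp_pos (-m)).le
    have := mul_le_mul_of_nonneg_left (hn2.trans he) (Real.exp_pos (-m)).le
    linarith
  rw [← ofReal_measureReal]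
  exact ENNReal.ofReal_le_ofReal h3

lemma hp_sq_expand {Ω κ : Type*} [MeasurableSpace Ω] (P : Measure Ω) (J : Finset κ) (f : κ → Ω → ℝ)
    (v : κ → ℝ) (hf : ∀ j k, Integrable (fun ω => f j ω * f k ω) P) :
    ∫ ω, (∑ j ∈ J, v j * f j ω) ^ 2 ∂P =
      ∑ j ∈ J, ∑ k ∈ J, v j * v k * ∫ ω, f j ω * f k ω ∂P := by
  have e : ∀ ω, (∑ j ∈ J, v j * f j ω) ^ 2 =
      ∑ j ∈ J, ∑ k ∈ J, v j * v k * (f j ω * f k ω) := by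
    intro ω
    rw [sq, Finset.sum_mul_sum]
    exact Finset.sum_congr rfl fun j _ => Finset.sum_congr rfl fun k _ => by ring
  simp_rw [e]
  rw [integral_finsetSum]
  · refine Finset.sum_congr rfl fun j _ => ?_
    rw [integral_finsetSum]
    · exact Finset.sum_congr rfl fun k _ => integral_const_mul _ _
    · exact fun k _ => (hf j k).const_mul _
  · exact fun j _ => integrable_finsetSum _ fun k _ => (hf j k).const_mul _

/-- The two polynomials used. -/
def hpPhi (k : ℕ) (s : ℝ) : ℝ := if k = 3 then s ^ 3 - 3 * s else s ^ 4 - 3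

/-- Their covariance functions. -/
def hpCov (k : ℕ) (t : ℝ) : ℝ := if k = 3 then 6 * t ^ 3 else 72 * t ^ 2 + 24 * t ^ 4

lemma hp_cov_pair (k : ℕ) (u v : ι → ℝ) (hu : ∑ i, u i ^ 2 = 1) (hv : ∑ i, v i ^ 2 = 1) :
    Integrable (fun g => hpPhi k (dotp g u) * hpPhi k (dotp g v)) (stdG ι) ∧
    ∫ g, hpPhi k (dotp g u) * hpPhi k (dotp g v) ∂(stdG ι) = hpCov k (dotp u v) := by
  obtain ⟨m1, m2, m3, m4, m5, m6⟩ := hp_mixed u v hu hv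
  obtain ⟨_, _, _, _, _, m7⟩ := hp_mixed v u hv hu
  have I := fun a b => hp_int_pow_mul u v a b
  by_cases hk : k = 3
  · simp only [hpPhi, hpCov, hk, if_true]
    have i11 := I 1 1
    have i31 := I 3 1
    have i13 := I 1 3
    have i33 := I 3 3
    simp only [pow_one] at i11 i31 i13
    have e : (fun g => (dotp g u ^ 3 - 3 * dotp g u) * (dotp g v ^ 3 - 3 * dotp g v)) =
        fun g => (dotp g u ^ 3 * dotp g v ^ 3 + 9 * (dotp g u * dotp g v)) -
          (3 * (dotp g u ^ 3 * dotp g v) + 3 * (dotp g u * dotp g v ^ 3)) := by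
      ext g; ring
    have j1 := i33.add (i11.const_mul 9)
    have j2 := (i31.const_mul 3).add (i13.const_mul 3)
    constructor
    · rw [e]; exact j1.sub j2
    · rw [e, integral_sub (by exact j1) (by exact j2), integral_add i33 (i11.const_mul 9),
        integral_add (i31.const_mul 3) (i13.const_mul 3),
        integral_const_mul, integral_const_mul, integral_const_mul, m1, m2, m3, m4]
      ring
  · simp only [hpPhi, hpCov, hk, if_false]
    have i44 := I 4 4
    have i40 := hp_int_pow u 4
    have i04 := hp_int_pow v 4
    have ic : Integrable (fun _ : ι → ℝ => (9 : ℝ)) (stdG ι) := integrable_const _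
    have e : (fun g => (dotp g u ^ 4 - 3) * (dotp g v ^ 4 - 3)) =
        fun g => (dotp g u ^ 4 * dotp g v ^ 4 + 9) -
          (3 * dotp g u ^ 4 + 3 * dotp g v ^ 4) := by
      ext g; ring
    have j1 := i44.add ic
    have j2 := (i40.const_mul 3).add (i04.const_mul 3)
    constructor
    · rw [e]; exact j1.sub j2
    · rw [e, integral_sub (by exact j1) (by exact j2), integral_add i44 ic,
        integral_add (i40.const_mul 3) (i04.const_mul 3),
        integral_const_mul, integral_const_mul, m5, m6, m7]
      simp
      ring

lemma hp_cov {κ : Type*} (k : ℕ) (J : Finset κ) (x : κ → ι → ℝ) (hx : ∀ j, ∑ i, x j i ^ 2 = 1)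
    (v : κ → ℝ) :
    ∫ g, (∑ j ∈ J, v j * hpPhi k (dotp g (x j))) ^ 2 ∂(stdG ι) =
      ∑ j ∈ J, ∑ l ∈ J, v j * v l * hpCov k (dotp (x j) (x l)) := by
  rw [hp_sq_expand _ J (fun j g => hpPhi k (dotp g (x j))) v
    fun j l => (hp_cov_pair k (x j) (x l) (hx j) (hx l)).1]
  refine Finset.sum_congr rfl fun j _ => Finset.sum_congr rfl fun l _ => ?_
  rw [(hp_cov_pair k (x j) (x l) (hx j) (hx l)).2]

end GaussianTails
section Decouple

variable {ι : Type*} [Fintype ι] [DecidableEq ι] {E : Type*} [MeasurableSpace E]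

/-- Take coordinates in `I` from the first argument, the others from the second. -/
def hpMerge (I : Finset ι) (z : (ι → E) × (ι → E)) : ι → E :=
  fun i => if i ∈ I then z.1 i else z.2 i

lemma hp_meas_merge (I : Finset ι) : Measurable (hpMerge (E := E) I) := by
  refine measurable_pi_lambda _ fun i => ?_
  unfold hpMerge
  by_cases h : i ∈ I
  · simp only [h, if_true]; fun_prop
  · simp only [h, if_false]; fun_prop

lemma hp_merge (μ : Measure E) [IsProbabilityMeasure μ] (I : Finset ι) :
    ((Measure.pi fun _ : ι => μ).prod (Measure.pi fun _ : ι => μ)).map (hpMerge I) =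
      Measure.pi fun _ : ι => μ := by
  symm
  refine Measure.pi_eq fun s hs => ?_
  rw [Measure.map_apply (hp_meas_merge I) (MeasurableSet.univ_pi hs)]
  have e : hpMerge I ⁻¹' (Set.univ.pi s) =
      (Set.univ.pi fun i => if i ∈ I then s i else Set.univ) ×ˢ
        (Set.univ.pi fun i => if i ∈ I then Set.univ else s i) := by
    ext z
    simp only [Set.mem_preimage, Set.mem_pi, Set.mem_univ, true_implies, Set.mem_prod, hpMerge]
    constructor
    · intro h
      refine ⟨fun i => ?_, fun i => ?_⟩ <;> have := h i <;> by_cases hi : i ∈ I <;> simp_all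
    · rintro ⟨h1, h2⟩ i
      have h1 := h1 i
      have h2 := h2 i
      by_cases hi : i ∈ I <;> simp_all
  rw [e, Measure.prod_prod, Measure.pi_pi, Measure.pi_pi, ← Finset.prod_mul_distrib]
  refine Finset.prod_congr rfl fun i _ => ?_
  by_cases hi : i ∈ I <;> simp [hi]

lemma hp_decouple (μ : Measure E) [IsProbabilityMeasure μ] (I : Finset ι)
    (A : Set ((ι → E) × (ι → E))) (hA : MeasurableSet A)
    (h1 : ∀ g g' x, (∀ i ∈ I, g i = g' i) → (g, x) ∈ A → (g', x) ∈ A)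
    (h2 : ∀ g x x', (∀ i ∉ I, x i = x' i) → (g, x) ∈ A → (g, x') ∈ A) (ε : ENNReal) :
    (Measure.pi fun _ : ι => μ) {ω | (ω, ω) ∈ A ∧
      (Measure.pi fun _ : ι => μ) {g | (g, ω) ∈ A} ≤ ε} ≤ ε := by
  set P := (Measure.pi fun _ : ι => μ) with hP
  have hm : Measurable fun x => P {g | (g, x) ∈ A} := measurable_measure_prodMk_right hA
  have hB : MeasurableSet {ω : ι → E | (ω, ω) ∈ A ∧ P {g | (g, ω) ∈ A} ≤ ε} := by
    refine MeasurableSet.inter ?_ ?_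
    · exact (measurable_id.prodMk measurable_id) hA
    · exact measurableSet_le hm measurable_const
  have hsec : ∀ x x' : ι → E, (∀ i ∉ I, x i = x' i) →
      P {g | (g, x) ∈ A} = P {g | (g, x') ∈ A} := by
    intro x x' hx
    congr 1; ext g
    exact ⟨h2 g x x' hx, h2 g x' x fun i hi => (hx i hi).symm⟩
  have hmap : P = (P.prod P).map (hpMerge I) := (hp_merge μ I).symm
  have e0 : P {ω : ι → E | (ω, ω) ∈ A ∧ P {g | (g, ω) ∈ A} ≤ ε} =
      ((P.prod P).map (hpMerge I)) {ω : ι → E | (ω, ω) ∈ A ∧ P {g | (g, ω) ∈ A} ≤ ε} :=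
    congrArg (fun m : Measure (ι → E) => m {ω : ι → E | (ω, ω) ∈ A ∧ P {g | (g, ω) ∈ A} ≤ ε}) hmap
  rw [e0, Measure.map_apply (hp_meas_merge I) hB]
  have hA' : MeasurableSet {z : (ι → E) × (ι → E) | z ∈ A ∧ P {g | (g, z.2) ∈ A} ≤ ε} :=
    MeasurableSet.inter hA (measurableSet_le (hm.comp measurable_snd) measurable_const)
  calc _ ≤ (P.prod P) {z : (ι → E) × (ι → E) | z ∈ A ∧ P {g | (g, z.2) ∈ A} ≤ ε} := by
        refine measure_mono fun z hz => ?_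
        obtain ⟨hz1, hz2⟩ := hz
        have hag : ∀ i ∉ I, hpMerge I z i = z.2 i := fun i hi => by simp [hpMerge, hi]
        refine ⟨?_, ?_⟩
        · have := h2 _ _ z.2 hag hz1
          exact h1 _ z.1 _ (fun i hi => by simp [hpMerge, hi]) this
        · rw [← hsec _ _ hag]; exact hz2
    _ = ∫⁻ x, P ((fun g => (g, x)) ⁻¹'
          {z : (ι → E) × (ι → E) | z ∈ A ∧ P {g | (g, z.2) ∈ A} ≤ ε}) ∂P :=
        Measure.prod_apply_symm hA'
    _ ≤ ∫⁻ x, ε ∂P := by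
        refine lintegral_mono fun x => ?_
        by_cases hx : P {g | (g, x) ∈ A} ≤ ε
        · exact (measure_mono fun g hg => hg.1).trans hx
        · have : ((fun g => (g, x)) ⁻¹'
            {z : (ι → E) × (ι → E) | z ∈ A ∧ P {g | (g, z.2) ∈ A} ≤ ε}) = ∅ := by
            ext g; simp only [Set.mem_preimage, Set.mem_ofPred_eq, Set.mem_empty_iff_false, iff_false]
            exact fun h => hx h.2
          rw [this]; simp
    _ = ε := by simp

end Decouple

section Rows

/-- normalization -/
def hpN {ι : Type*} [Fintype ι] (x : ι → ℝ) : ι → ℝ := (enorm2 x)⁻¹ • x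

lemma hp_meas_N {ι : Type*} [Fintype ι] : Measurable (hpN (ι := ι)) := by
  unfold hpN enorm2; fun_prop

lemma hp_N_le {ι : Type*} [Fintype ι] (x : ι → ℝ) : ∑ i, hpN x i ^ 2 ≤ 1 := by
  have hnn : 0 ≤ ∑ i, x i ^ 2 := Finset.sum_nonneg fun _ _ => sq_nonneg _
  simp only [hpN, Pi.smul_apply, smul_eq_mul, mul_pow, ← Finset.mul_sum, enorm2, inv_pow,
    Real.sq_sqrt hnn]
  exact inv_mul_le_one

variable {p d : ℕ}

lemma hp_open_bad {ι κ : Type*} [Fintype ι] [Fintype κ] (c : ℝ) :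
    MeasurableSet {y : ι → κ → ℝ | ¬ ∀ v : κ → ℝ, ∑ i, (∑ j, y i j * v j) ^ 2 ≤ c * ∑ j, v j ^ 2} := by
  have : {y : ι → κ → ℝ | ¬ ∀ v : κ → ℝ, ∑ i, (∑ j, y i j * v j) ^ 2 ≤ c * ∑ j, v j ^ 2} =
      ⋃ v : κ → ℝ, {y | c * ∑ j, v j ^ 2 < ∑ i, (∑ j, y i j * v j) ^ 2} := by
    ext y; simp only [Set.mem_ofPred_eq, Set.mem_iUnion]; push Not; rfl
  rw [this]
  refine IsOpen.measurableSet (isOpen_iUnion fun v => ?_)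
  exact isOpen_lt (by fun_prop) (by fun_prop)

/-- Marginal of a product measure. -/
lemma hp_marg {E : Type*} [MeasurableSpace E] (μ : Measure E) [IsProbabilityMeasure μ] (i : Fin p)
    (s : Set E) : (Measure.pi fun _ : Fin p => μ) {ω | ω i ∈ s} ≤ μ s := by
  have h := measurePreserving_eval (μ := fun _ : Fin p => μ) i
  calc (Measure.pi fun _ : Fin p => μ) {ω | ω i ∈ s}
      ≤ ((Measure.pi fun _ : Fin p => μ).map (Function.eval i)) s :=
        Measure.le_map_apply h.measurable.aemeasurable s
    _ = μ s := by rw [h.map_eq]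

/-- truncated rows -/
def hpTr (k : ℕ) (b : ℝ) (J : Finset (Fin p)) (x : Fin p → Fin d → ℝ) (g : Fin d → ℝ) (j : Fin p) : ℝ :=
  if j ∈ J ∧ ∑ l ∈ J, hpPhi k (dotp g (x l)) ^ 2 ≤ b then hpPhi k (dotp g (x j)) else 0

lemma hp_meas_phi (k : ℕ) : Measurable (hpPhi k) := by
  unfold hpPhi; split_ifs <;> fun_prop

lemma hp_meas_Tr {Ω : Type*} [MeasurableSpace Ω] (k : ℕ) (b : ℝ) (J : Finset (Fin p))
    (x : Ω → Fin p → Fin d → ℝ) (hx : Measurable x) (g : Ω → Fin d → ℝ) (hg : Measurable g) (j : Fin p) :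
    Measurable fun ω => hpTr k b J (x ω) (g ω) j := by
  unfold hpTr
  have h1 : ∀ l, Measurable fun ω => hpPhi k (dotp (g ω) (x ω l)) := by
    intro l
    refine (hp_meas_phi k).comp ?_
    unfold dotp; fun_prop
  by_cases hj : j ∈ J
  · simp only [hj, true_and]
    refine Measurable.ite ?_ (h1 j) measurable_const
    exact measurableSet_le (Finset.measurable_sum _ fun l _ => (h1 l).pow_const 2) measurable_const
  · simp only [hj, false_and, if_false]; exact measurable_const

lemma hp_Tr_sq (k : ℕ) (b : ℝ) (hb : 0 ≤ b) (J : Finset (Fin p)) (x : Fin p → Fin d → ℝ)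
    (g : Fin d → ℝ) : ∑ j, hpTr k b J x g j ^ 2 ≤ b := by
  by_cases h : ∑ l ∈ J, hpPhi k (dotp g (x l)) ^ 2 ≤ b
  · refine le_trans (le_of_eq ?_) h
    simp only [hpTr, h, and_true]
    rw [← Finset.sum_filter_add_sum_filter_not Finset.univ (· ∈ J)]
    rw [Finset.sum_eq_zero (s := Finset.univ.filter (· ∉ J))]
    · simp only [Finset.filter_mem_eq_inter, Finset.univ_inter, add_zero]
      exact Finset.sum_congr rfl fun j hj => by simp [hj]
    · intro j hj; simp at hj; simp [hj]
  · simp only [hpTr, h, and_false, if_false]; simpa using hb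

lemma hp_Tr_lin (k : ℕ) (b : ℝ) (J : Finset (Fin p)) (x : Fin p → Fin d → ℝ)
    (g : Fin d → ℝ) (v : Fin p → ℝ) : ∑ j, v j * hpTr k b J x g j =
      if ∑ l ∈ J, hpPhi k (dotp g (x l)) ^ 2 ≤ b then ∑ j ∈ J, v j * hpPhi k (dotp g (x j)) else 0 := by
  by_cases h : ∑ l ∈ J, hpPhi k (dotp g (x l)) ^ 2 ≤ b
  · simp only [hpTr, h, and_true, if_true, mul_ite, mul_zero]
    rw [← Finset.sum_filter]
    simp
  · simp [hpTr, h]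

lemma hp_rows_fixed (k : ℕ) (b Q L : ℝ) (hb0 : 0 < b) (hQ0 : 0 ≤ Q) (n : ℕ) (hn : 0 < n)
    (I J : Finset (Fin p)) (x : Fin p → Fin d → ℝ) (hx : ∀ j, ∑ i, x j i ^ 2 = 1)
    (hL1 : Real.exp 1 * p * Q ≤ L) (hL2 : n * b ≤ L)
    (hcond : ∀ v : Fin p → ℝ, ∑ j ∈ J, ∑ l ∈ J, v j * v l * hpCov k (dotp (x j) (x l)) ≤
      Q * ∑ j, v j ^ 2) :
    (Measure.pi fun _ : Fin p => stdG (Fin d)) {g | ¬ ∀ v : Fin p → ℝ,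
      ∑ i, (∑ j, (if i ∈ I then hpTr k b J x (g i) j else 0) * v j) ^ 2 ≤
        Real.exp 1 * L * ∑ j, v j ^ 2} ≤ ENNReal.ofReal ((p + p * n) * Real.exp (-n)) := by
  have hr : ∀ i, Measurable fun g : Fin d → ℝ => fun j => if i ∈ I then hpTr k b J x g j else 0 := by
    intro i
    refine measurable_pi_lambda _ fun j => ?_
    by_cases hi : i ∈ I
    · simp only [hi, if_true]
      exact hp_meas_Tr k b J (fun _ => x) measurable_const _ measurable_id j
    · simp only [hi, if_false]; exact measurable_const
  have h := hp_chernoff (Measure.pi fun _ : Fin p => stdG (Fin d))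
    (fun i ω j => if i ∈ I then hpTr k b J x (ω i) j else 0)
    (fun i => (hr i).comp (measurable_pi_apply i))
    (iIndepFun_pi (X := fun i g j => if i ∈ I then hpTr k b J x g j else 0)
      fun i => (hr i).aemeasurable) b Q hb0 hQ0
    (by
      intro i ω
      by_cases hi : i ∈ I
      · simp only [hi, if_true]; exact hp_Tr_sq k b hb0.le J x (ω i)
      · simp [hi, hb0.le])
    (by
      intro i v
      have hnn : 0 ≤ Q * ∑ j, v j ^ 2 := mul_nonneg hQ0 (Finset.sum_nonneg fun _ _ => sq_nonneg _)
      by_cases hi : i ∈ I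
      · simp only [hi, if_true]
        have hmp := measurePreserving_eval (μ := fun _ : Fin p => stdG (Fin d)) i
        have e : ∫ ω, (∑ j, v j * hpTr k b J x (ω i) j) ^ 2
            ∂(Measure.pi fun _ : Fin p => stdG (Fin d)) =
            ∫ g, (∑ j, v j * hpTr k b J x g j) ^ 2 ∂(stdG (Fin d)) := by
          have hmm : Measurable fun g : Fin d → ℝ => (∑ j, v j * hpTr k b J x g j) ^ 2 := by
            refine Measurable.pow_const (Finset.measurable_sum _ fun j _ => ?_) 2
            exact (hp_meas_Tr k b J (fun _ => x) measurable_const _ measurable_id j).const_mul _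
          have hh := integral_map (μ := Measure.pi fun _ : Fin p => stdG (Fin d)) hmp.measurable.aemeasurable
            (f := fun g : Fin d → ℝ => (∑ j, v j * hpTr k b J x g j) ^ 2)
            hmm.aestronglyMeasurable
          rw [hmp.map_eq] at hh
          exact hh.symm
        rw [e]
        refine le_trans ?_ (hcond v)
        rw [← hp_cov k J x hx v]
        refine integral_mono_of_nonneg (Filter.Eventually.of_forall fun g => sq_nonneg _) ?_
          (Filter.Eventually.of_forall fun g => ?_)
        · have e : ∀ g, (∑ j ∈ J, v j * hpPhi k (dotp g (x j))) ^ 2 =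
              ∑ j ∈ J, ∑ l ∈ J, v j * v l * (hpPhi k (dotp g (x j)) * hpPhi k (dotp g (x l))) := by
            intro ω
            rw [sq, Finset.sum_mul_sum]
            exact Finset.sum_congr rfl fun j _ => Finset.sum_congr rfl fun k _ => by ring
          simp_rw [e]
          exact integrable_finsetSum _ fun j _ => integrable_finsetSum _ fun l _ =>
            ((hp_cov_pair k (x j) (x l) (hx j) (hx l)).1).const_mul _
        · simp only
          rw [hp_Tr_lin]
          split_ifs
          · exact le_rfl
          · simpa using sq_nonneg _
      · simpa [hi] using hnn)
    n hn L (by simpa using hL1) hL2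
  simpa using h

/-- The block event. -/
lemma hp_block (k : ℕ) (b Q L : ℝ) (hb0 : 0 < b) (hQ0 : 0 ≤ Q) (n : ℕ) (hn : 0 < n)
    (I J : Finset (Fin p)) (hIJ : Disjoint I J)
    (hL1 : Real.exp 1 * p * Q ≤ L) (hL2 : n * b ≤ L) :
    (Measure.pi fun _ : Fin p => stdG (Fin d)) {ω |
      (∀ j, ∑ i, hpN (ω j) i ^ 2 = 1) ∧
      (∀ v : Fin p → ℝ, ∑ j ∈ J, ∑ l ∈ J, v j * v l * hpCov k (dotp (hpN (ω j)) (hpN (ω l))) ≤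
        Q * ∑ j, v j ^ 2) ∧
      (∀ i ∈ I, ∑ j ∈ J, hpPhi k (dotp (ω i) (hpN (ω j))) ^ 2 ≤ b) ∧
      ¬ ∀ v : Fin p → ℝ, ∑ i ∈ I, (∑ j ∈ J, hpPhi k (dotp (ω i) (hpN (ω j))) * v j) ^ 2 ≤
        Real.exp 1 * L * ∑ j, v j ^ 2} ≤ ENNReal.ofReal ((p + p * n) * Real.exp (-n)) := by
  set A : Set ((Fin p → Fin d → ℝ) × (Fin p → Fin d → ℝ)) := {z | ¬ ∀ v : Fin p → ℝ,
      ∑ i, (∑ j, (if i ∈ I then hpTr k b J (fun l => hpN (z.2 l)) (z.1 i) j else 0) * v j) ^ 2 ≤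
        Real.exp 1 * L * ∑ j, v j ^ 2} with hAdef
  have hA : MeasurableSet A := by
    have hm : Measurable fun z : (Fin p → Fin d → ℝ) × (Fin p → Fin d → ℝ) =>
        fun i j => if i ∈ I then hpTr k b J (fun l => hpN (z.2 l)) (z.1 i) j else 0 := by
      refine measurable_pi_lambda _ fun i => measurable_pi_lambda _ fun j => ?_
      by_cases hi : i ∈ I
      · simp only [hi, if_true]
        refine hp_meas_Tr k b J (fun z : (Fin p → Fin d → ℝ) × (Fin p → Fin d → ℝ) =>
          fun l => hpN (z.2 l)) ?_ (fun z => z.1 i) (by fun_prop) j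
        refine measurable_pi_lambda _ fun l => hp_meas_N.comp (by fun_prop)
      · simp only [hi, if_false]; exact measurable_const
    exact hm (hp_open_bad (Real.exp 1 * L))
  have hd := hp_decouple (stdG (Fin d)) I A hA
    (by
      intro g g' x hg h
      have e : ∀ i j, (if i ∈ I then hpTr k b J (fun l => hpN (x l)) (g i) j else 0) =
          (if i ∈ I then hpTr k b J (fun l => hpN (x l)) (g' i) j else 0) := by
        intro i j
        by_cases hi : i ∈ I
        · simp only [hi, if_true, hg i hi]
        · simp [hi]
      simp only [hAdef, Set.mem_ofPred_eq, e] at h ⊢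
      exact h)
    (by
      intro g x x' hx h
      have hx' : ∀ l ∈ J, x l = x' l := fun l hl => hx l (Finset.disjoint_right.mp hIJ hl)
      have e : ∀ i j, hpTr k b J (fun l => hpN (x l)) (g i) j =
          hpTr k b J (fun l => hpN (x' l)) (g i) j := by
        intro i j
        unfold hpTr
        have : ∑ l ∈ J, hpPhi k (dotp (g i) (hpN (x l))) ^ 2 =
          ∑ l ∈ J, hpPhi k (dotp (g i) (hpN (x' l))) ^ 2 :=
          Finset.sum_congr rfl fun l hl => by rw [hx' l hl]
        simp only [this]
        by_cases hj : j ∈ J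
        · simp only [hj, hx' j hj]
        · simp [hj]
      simp only [hAdef, Set.mem_ofPred_eq, e] at h ⊢
      exact h)
    (ENNReal.ofReal ((p + p * n) * Real.exp (-n)))
  refine le_trans (measure_mono ?_) hd
  rintro ω ⟨h1, h2, h3, h4⟩
  refine ⟨?_, ?_⟩
  · simp only [hAdef, Set.mem_ofPred_eq]
    intro h
    apply h4
    intro v
    refine le_trans (le_of_eq ?_) (h v)
    rw [← Finset.sum_filter_add_sum_filter_not Finset.univ (· ∈ I)]
    rw [Finset.sum_eq_zero (s := Finset.univ.filter (· ∉ I))]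
    · simp only [Finset.filter_mem_eq_inter, Finset.univ_inter, add_zero]
      refine Finset.sum_congr rfl fun i hi => ?_
      simp only [hi, if_true]
      have := hp_Tr_lin k b J (fun l => hpN (ω l)) (ω i) v
      rw [if_pos (h3 i hi)] at this
      simp only [mul_comm (v _)] at this
      rw [this]
    · intro i hi; simp at hi; simp [hi]
  · exact hp_rows_fixed k b Q L hb0 hQ0 n hn I J (fun l => hpN (ω l)) h1 hL1 hL2 h2

/-- Norm event. -/
lemma hp_G1 (hd : 1 ≤ d) (m : ℝ) (i : Fin p) :
    (Measure.pi fun _ : Fin p => stdG (Fin d)) {ω | 4 * m * √d < |∑ l, ω i l ^ 2 - d|} ≤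
      ENNReal.ofReal (4 * Real.exp (-m)) :=
  (hp_marg (stdG (Fin d)) i {g | 4 * m * √d < |∑ l, g l ^ 2 - d|}).trans (hp_chi d hd m)

/-- Inner product event. -/
lemma hp_G2 (R : ℝ) (i j : Fin p) (hij : i ≠ j) :
    (Measure.pi fun _ : Fin p => stdG (Fin d)) {ω | R < |dotp (ω i) (hpN (ω j))|} ≤
      ENNReal.ofReal (4 * Real.exp (-R)) := by
  have hd := hp_decouple (stdG (Fin d)) {i}
    {z : (Fin p → Fin d → ℝ) × (Fin p → Fin d → ℝ) | R < |dotp (z.1 i) (hpN (z.2 j))|}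
    (by
      refine measurableSet_lt measurable_const ?_
      have h1 : Measurable fun z : (Fin p → Fin d → ℝ) × (Fin p → Fin d → ℝ) => hpN (z.2 j) :=
        hp_meas_N.comp (by fun_prop)
      unfold dotp; fun_prop)
    (by
      intro g g' x hg h
      simp only [Set.mem_ofPred_eq] at *
      rw [← hg i (by simp)]; exact h)
    (by
      intro g x x' hx h
      simp only [Set.mem_ofPred_eq] at *
      rw [← hx j (by simpa using hij.symm)]; exact h)
    (ENNReal.ofReal (4 * Real.exp (-R)))
  refine le_trans (measure_mono ?_) hd
  intro ω hω
  exact ⟨hω, (hp_marg (stdG (Fin d)) i {g | R < |dotp g (hpN (ω j))|}).trans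
    (hp_tail _ (hp_N_le _) R)⟩

/-- Covariance event. -/
lemma hp_G3 (b L : ℝ) (hb0 : 0 < b) (n : ℕ) (hn : 0 < n)
    (hL1 : Real.exp 1 * p ≤ L) (hL2 : n * b ≤ L) :
    (Measure.pi fun _ : Fin p => stdG (Fin d)) {ω |
      (∀ i, ∑ l, ω i l ^ 2 ≤ b) ∧
      ¬ ∀ v : Fin d → ℝ, ∑ i, (dotp (ω i) v) ^ 2 ≤
        Real.exp 1 * L * ∑ j, v j ^ 2} ≤ ENNReal.ofReal ((d + p * n) * Real.exp (-n)) := by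
  have hr : Measurable fun g : Fin d → ℝ => fun j => if ∑ l, g l ^ 2 ≤ b then g j else 0 := by
    refine measurable_pi_lambda _ fun j => ?_
    refine Measurable.ite (measurableSet_le (by fun_prop) measurable_const) (by fun_prop) measurable_const
  have h := hp_chernoff (Measure.pi fun _ : Fin p => stdG (Fin d))
    (fun i ω j => if ∑ l, ω i l ^ 2 ≤ b then ω i j else 0)
    (fun i => hr.comp (measurable_pi_apply i))
    (iIndepFun_pi (X := fun i (g : Fin d → ℝ) j => if ∑ l, g l ^ 2 ≤ b then g j else 0)
      fun i => hr.aemeasurable) b 1 hb0 zero_le_one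
    (by
      intro i ω
      by_cases hi : ∑ l, ω i l ^ 2 ≤ b
      · simp only [hi, if_true]
      · simp [hi, hb0.le])
    (by
      intro i v
      have hmp := measurePreserving_eval (μ := fun _ : Fin p => stdG (Fin d)) i
      have hmm : Measurable fun g : Fin d → ℝ =>
          (∑ j, v j * (if ∑ l, g l ^ 2 ≤ b then g j else 0)) ^ 2 := by
        refine Measurable.pow_const (Finset.measurable_sum _ fun j _ => ?_) 2
        exact ((measurable_pi_apply j).comp hr).const_mul _
      have hh := integral_map (μ := Measure.pi fun _ : Fin p => stdG (Fin d)) hmp.measurable.aemeasurable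
        (f := fun g : Fin d → ℝ => (∑ j, v j * (if ∑ l, g l ^ 2 ≤ b then g j else 0)) ^ 2)
        hmm.aestronglyMeasurable
      rw [hmp.map_eq] at hh
      simp only [Function.eval] at hh
      rw [← hh]
      have h2 := hp_dotp_moment v 1
      simp only [mul_one, pow_one, hp_gm.1] at h2
      rw [one_mul, ← h2]
      refine integral_mono_of_nonneg (Filter.Eventually.of_forall fun g => sq_nonneg _)
        (hp_int_pow v 2) (Filter.Eventually.of_forall fun g => ?_)
      simp only
      by_cases hi : ∑ l, g l ^ 2 ≤ b
      · simp only [hi, if_true, dotp, mul_comm (v _)]; exact le_rfl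
      · simpa [hi] using sq_nonneg _)
    n hn L (by simpa using hL1) hL2
  simp only [Fintype.card_fin] at h
  refine le_trans (measure_mono ?_) h
  rintro ω ⟨h1, h2⟩ h3
  apply h2
  intro v
  have := h3 v
  simp only [h1, if_true] at this
  exact this

end Rows
section Bilinear

variable {p : ℕ}

/-- Bilinear form bound on a block. -/
def HpBB (A : Fin p → Fin p → ℝ) (I J : Finset (Fin p)) (β : ℝ) : Prop :=
  ∀ u v : Fin p → ℝ, |∑ i ∈ I, ∑ j ∈ J, u i * A i j * v j| ≤
    β * √(∑ i ∈ I, u i ^ 2) * √(∑ j ∈ J, v j ^ 2)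

lemma hp_ssq_nonneg (I : Finset (Fin p)) (u : Fin p → ℝ) : 0 ≤ ∑ i ∈ I, u i ^ 2 :=
  Finset.sum_nonneg fun _ _ => sq_nonneg _

lemma HpBB.mono {A : Fin p → Fin p → ℝ} {I J : Finset (Fin p)} {β β' : ℝ} (h : HpBB A I J β)
    (hb : β ≤ β') : HpBB A I J β' := fun u v => (h u v).trans (by gcongr)

lemma HpBB.congr {A B : Fin p → Fin p → ℝ} {I J : Finset (Fin p)} {β : ℝ} (h : HpBB A I J β)
    (hb : ∀ i ∈ I, ∀ j ∈ J, A i j = B i j) : HpBB B I J β := by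
  intro u v
  have e : ∑ i ∈ I, ∑ j ∈ J, u i * A i j * v j = ∑ i ∈ I, ∑ j ∈ J, u i * B i j * v j :=
    Finset.sum_congr rfl fun i hi => Finset.sum_congr rfl fun j hj => by rw [hb i hi j hj]
  rw [← e]
  exact h u v

lemma HpBB.add {A B : Fin p → Fin p → ℝ} {I J : Finset (Fin p)} {β γ : ℝ} (h : HpBB A I J β)
    (h' : HpBB B I J γ) : HpBB (fun i j => A i j + B i j) I J (β + γ) := by
  intro u v
  have e : ∑ i ∈ I, ∑ j ∈ J, u i * (A i j + B i j) * v j =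
      ∑ i ∈ I, ∑ j ∈ J, u i * A i j * v j + ∑ i ∈ I, ∑ j ∈ J, u i * B i j * v j := by
    simp only [← Finset.sum_add_distrib]
    exact Finset.sum_congr rfl fun i _ => Finset.sum_congr rfl fun j _ => by ring
  rw [e]
  calc _ ≤ _ := abs_add_le _ _
    _ ≤ _ := add_le_add (h u v) (h' u v)
    _ = _ := by ring

lemma HpBB.smul {A : Fin p → Fin p → ℝ} {I J : Finset (Fin p)} {β : ℝ} (h : HpBB A I J β)
    (c : ℝ) (hc : 0 ≤ c) : HpBB (fun i j => c * A i j) I J (c * β) := by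
  intro u v
  have e : ∑ i ∈ I, ∑ j ∈ J, u i * (c * A i j) * v j = c * ∑ i ∈ I, ∑ j ∈ J, u i * A i j * v j := by
    simp only [Finset.mul_sum]
    exact Finset.sum_congr rfl fun i _ => Finset.sum_congr rfl fun j _ => by ring
  rw [e, abs_mul, abs_of_nonneg hc, mul_assoc, mul_assoc, ← mul_assoc β]
  exact mul_le_mul_of_nonneg_left (h u v) hc

/-- row scaling -/
lemma HpBB.row {A : Fin p → Fin p → ℝ} {I J : Finset (Fin p)} {β : ℝ} (h : HpBB A I J β)
    (hβ : 0 ≤ β) (c : Fin p → ℝ) (γ : ℝ) (hγ : 0 ≤ γ) (hc : ∀ i ∈ I, |c i| ≤ γ) :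
    HpBB (fun i j => c i * A i j) I J (γ * β) := by
  intro u v
  have e : ∑ i ∈ I, ∑ j ∈ J, u i * (c i * A i j) * v j =
      ∑ i ∈ I, ∑ j ∈ J, (u i * c i) * A i j * v j :=
    Finset.sum_congr rfl fun i _ => Finset.sum_congr rfl fun j _ => by ring
  rw [e]
  refine (h (fun i => u i * c i) v).trans ?_
  have h2 : √(∑ i ∈ I, (u i * c i) ^ 2) ≤ γ * √(∑ i ∈ I, u i ^ 2) := by
    rw [← Real.sqrt_sq hγ, ← Real.sqrt_mul (sq_nonneg γ), Finset.mul_sum]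
    refine Real.sqrt_le_sqrt (Finset.sum_le_sum fun i hi => ?_)
    have : c i ^ 2 ≤ γ ^ 2 := sq_le_sq' (by linarith [abs_le.mp (hc i hi)]) (abs_le.mp (hc i hi)).2
    rw [mul_pow, mul_comm]
    exact mul_le_mul_of_nonneg_right this (sq_nonneg _)
  calc _ ≤ β * (γ * √(∑ i ∈ I, u i ^ 2)) * √(∑ j ∈ J, v j ^ 2) := by gcongr
    _ = _ := by ring

lemma hp_abs_sum_le (I : Finset (Fin p)) (u : Fin p → ℝ) :
    ∑ i ∈ I, |u i| ≤ √p * √(∑ i ∈ I, u i ^ 2) := by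
  have h := Finset.sum_mul_sq_le_sq_mul_sq I (fun _ => (1 : ℝ)) (fun i => |u i|)
  simp only [one_mul, one_pow, sq_abs, Finset.sum_const, nsmul_eq_mul, mul_one] at h
  rw [← Real.sqrt_mul (Nat.cast_nonneg p)]
  apply Real.le_sqrt_of_sq_le
  refine h.trans ?_
  have : (I.card : ℝ) ≤ p := by
    have := Finset.card_le_univ I
    simp at this; exact_mod_cast this
  exact mul_le_mul_of_nonneg_right this (hp_ssq_nonneg I u)

lemma hp_bb_entry {A : Fin p → Fin p → ℝ} {I J : Finset (Fin p)} (γ : ℝ) (hγ : 0 ≤ γ)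
    (h : ∀ i ∈ I, ∀ j ∈ J, |A i j| ≤ γ) : HpBB A I J (p * γ) := by
  intro u v
  calc |∑ i ∈ I, ∑ j ∈ J, u i * A i j * v j|
      ≤ ∑ i ∈ I, ∑ j ∈ J, |u i| * γ * |v j| := by
        refine (Finset.abs_sum_le_sum_abs _ _).trans (Finset.sum_le_sum fun i hi => ?_)
        refine (Finset.abs_sum_le_sum_abs _ _).trans (Finset.sum_le_sum fun j hj => ?_)
        rw [abs_mul, abs_mul]
        have := h i hi j hj
        gcongr
    _ = γ * ((∑ i ∈ I, |u i|) * ∑ j ∈ J, |v j|) := by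
        rw [Finset.sum_mul_sum, Finset.mul_sum]
        refine Finset.sum_congr rfl fun i _ => ?_
        rw [Finset.mul_sum]
        exact Finset.sum_congr rfl fun j _ => by ring
    _ ≤ γ * ((√p * √(∑ i ∈ I, u i ^ 2)) * (√p * √(∑ i ∈ J, v i ^ 2))) := by
        have h1 := hp_abs_sum_le I u
        have h2 := hp_abs_sum_le J v
        have : 0 ≤ ∑ j ∈ J, |v j| := Finset.sum_nonneg fun _ _ => abs_nonneg _
        gcongr
    _ = γ * (√p * √p) * √(∑ i ∈ I, u i ^ 2) * √(∑ i ∈ J, v i ^ 2) := by ring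
    _ = _ := by rw [Real.mul_self_sqrt (Nat.cast_nonneg p)]; ring

lemma hp_bb_diag (I : Finset (Fin p)) (c γ : ℝ) (hγ : |c| ≤ γ) :
    HpBB (fun i j => if i = j then c else 0) I I γ := by
  intro u v
  have e : ∑ i ∈ I, ∑ j ∈ I, u i * (if i = j then c else 0) * v j = c * ∑ i ∈ I, u i * v i := by
    rw [Finset.mul_sum]
    refine Finset.sum_congr rfl fun i hi => ?_
    simp only [mul_ite, mul_zero, ite_mul, zero_mul]
    rw [Finset.sum_ite_eq]
    simp only [hi, if_true]; ring
  rw [e, abs_mul, mul_assoc]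
  have h0 : 0 ≤ γ := (abs_nonneg c).trans hγ
  have h := Finset.sum_mul_sq_le_sq_mul_sq I u v
  have h2 : |∑ i ∈ I, u i * v i| ≤ √(∑ i ∈ I, u i ^ 2) * √(∑ i ∈ I, v i ^ 2) := by
    rw [← Real.sqrt_mul (hp_ssq_nonneg I u)]
    exact Real.abs_le_sqrt h
  gcongr

lemma HpBB.opNorm {A : Fin p → Fin p → ℝ} {β : ℝ} (hβ : 0 ≤ β)
    (h : HpBB A Finset.univ Finset.univ β) : opNorm A ≤ β := by
  unfold _root_.opNorm
  refine Real.iSup_le (fun v => ?_) hβ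
  have h1 := h (fun i => ∑ j, A i j * v.1 j) v.1
  set S := ∑ i, (∑ j, A i j * v.1 j) ^ 2 with hS
  have e : ∑ i, ∑ j, (∑ j, A i j * v.1 j) * A i j * v.1 j = S := by
    rw [hS]
    refine Finset.sum_congr rfl fun i _ => ?_
    rw [sq, Finset.mul_sum]
    exact Finset.sum_congr rfl fun j _ => by ring
  have hS0 : 0 ≤ S := hp_ssq_nonneg Finset.univ _
  rw [e, abs_of_nonneg hS0] at h1
  have h2 : √(∑ j, v.1 j ^ 2) ≤ 1 := by
    rw [Real.sqrt_le_one]; exact v.2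
  by_contra hc
  push Not at hc
  have h3 : 0 < √S := lt_of_le_of_lt hβ hc
  have h4 : β * √S * √(∑ j, v.1 j ^ 2) ≤ β * √S :=
    mul_le_of_le_one_right (by positivity) h2
  have h5 := Real.mul_self_sqrt hS0
  nlinarith

/-- Integer interval in `Fin p`. -/
def hpIv (p a b : ℕ) : Finset (Fin p) := Finset.univ.filter fun i => a ≤ i.val ∧ i.val < b

lemma hp_iv_disj (a b c : ℕ) : Disjoint (hpIv p a b) (hpIv p b c) := by
  rw [Finset.disjoint_left]
  intro i h1 h2
  simp only [hpIv, Finset.mem_filter] at h1 h2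
  omega

lemma hp_iv_split (a b c : ℕ) (h1 : a ≤ b) (h2 : b ≤ c) : hpIv p a c = hpIv p a b ∪ hpIv p b c := by
  ext i
  simp only [hpIv, Finset.mem_filter, Finset.mem_union, Finset.mem_univ, true_and]
  omega

lemma hp_two_cs (a b c d : ℝ) (ha : 0 ≤ a) (hb : 0 ≤ b) (hc : 0 ≤ c) (hd : 0 ≤ d) :
    √a * √c + √b * √d ≤ √(a + b) * √(c + d) := by
  rw [← Real.sqrt_mul (show 0 ≤ a + b by positivity)]
  apply Real.le_sqrt_of_sq_le
  have ea := Real.sq_sqrt ha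
  have eb := Real.sq_sqrt hb
  have ec := Real.sq_sqrt hc
  have ed := Real.sq_sqrt hd
  nlinarith [sq_nonneg (√a * √d - √b * √c)]

lemma hp_dyadic (H : Fin p → Fin p → ℝ) (hsym : ∀ i j, H i j = H j i) (hdiag : ∀ i, H i i = 0)
    (β : ℝ) (hβ : 0 ≤ β) (S : ℕ)
    (hblock : ∀ s ≤ S, ∀ a b c : ℕ, a ≤ b → b ≤ c → c ≤ p →
      HpBB H (hpIv p b c) (hpIv p b c) (s * β) →
      HpBB H (hpIv p a b) (hpIv p b c) β) :
    ∀ s ≤ S, ∀ a c : ℕ, a ≤ c → c ≤ p → c - a ≤ 2 ^ s →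
      HpBB H (hpIv p a c) (hpIv p a c) (s * β) := by
  intro s
  induction s with
  | zero =>
    intro _ a c hac hcp hlen u v
    have : ∑ i ∈ hpIv p a c, ∑ j ∈ hpIv p a c, u i * H i j * v j = 0 := by
      refine Finset.sum_eq_zero fun i hi => Finset.sum_eq_zero fun j hj => ?_
      simp only [hpIv, Finset.mem_filter] at hi hj
      have : i = j := Fin.ext (by simp at hlen; omega)
      rw [this, hdiag]; ring
    rw [this]; simp
  | succ s ih =>
    intro hs a c hac hcp hlen
    set b := min c (a + 2 ^ s) with hb
    have hpow : 2 ^ (s + 1) = 2 ^ s + 2 ^ s := by rw [pow_succ]; ring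
    have hab : a ≤ b := by omega
    have hbc : b ≤ c := by omega
    have h1 := ih (by omega) a b hab (by omega) (by omega)
    have h2 := ih (by omega) b c hbc hcp (by omega)
    have h3 := hblock s (by omega) a b c hab hbc hcp h2
    intro u v
    have hdis := hp_iv_disj (p := p) a b c
    rw [hp_iv_split a b c hab hbc]
    have e : ∑ i ∈ hpIv p a b ∪ hpIv p b c, ∑ j ∈ hpIv p a b ∪ hpIv p b c, u i * H i j * v j =
      (∑ i ∈ hpIv p a b, ∑ j ∈ hpIv p a b, u i * H i j * v j) +
      (∑ i ∈ hpIv p a b, ∑ j ∈ hpIv p b c, u i * H i j * v j) +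
      (∑ i ∈ hpIv p a b, ∑ j ∈ hpIv p b c, v i * H i j * u j) +
      (∑ i ∈ hpIv p b c, ∑ j ∈ hpIv p b c, u i * H i j * v j) := by
      have e1 : ∑ i ∈ hpIv p a b, ∑ j ∈ hpIv p b c, v i * H i j * u j =
          ∑ i ∈ hpIv p b c, ∑ j ∈ hpIv p a b, u i * H i j * v j := by
        rw [Finset.sum_comm]
        exact Finset.sum_congr rfl fun i _ => Finset.sum_congr rfl fun j _ => by
          rw [hsym j i]; ring
      rw [Finset.sum_union hdis, e1]
      simp only [Finset.sum_union hdis, Finset.sum_add_distrib]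
      ring
    rw [e, Finset.sum_union hdis, Finset.sum_union hdis]
    have t1 := h1 u v
    have t2 := h2 u v
    have t3 := h3 u v
    have t4 := h3 v u
    have a1 := hp_ssq_nonneg (hpIv p a b) u
    have a2 := hp_ssq_nonneg (hpIv p b c) u
    have a3 := hp_ssq_nonneg (hpIv p a b) v
    have a4 := hp_ssq_nonneg (hpIv p b c) v
    have c1 := hp_two_cs _ _ _ _ a1 a2 a3 a4
    have c2 := hp_two_cs _ _ _ _ a1 a2 a4 a3
    rw [add_comm (∑ i ∈ hpIv p b c, v i ^ 2)] at c2
    have d1 := mul_le_mul_of_nonneg_left c1 (show 0 ≤ (s : ℝ) * β by positivity)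
    have d2 := mul_le_mul_of_nonneg_left c2 hβ
    refine (abs_add_le _ _).trans ?_
    refine (add_le_add ((abs_add_le _ _).trans (add_le_add (abs_add_le _ _) le_rfl)) le_rfl).trans ?_
    push_cast
    nlinarith

end Bilinear
section Deterministic

variable {p : ℕ}

/-- The deterministic good properties; `q = √d`. -/
structure HpDet (p : ℕ) (q R C0 C1 : ℝ) (n : Fin p → ℝ) (t : Fin p → Fin p → ℝ) : Prop where
  hR : 1 ≤ R
  hq : 2 * R ≤ q
  hC0 : 0 < C0
  hC1 : 0 < C1
  hp : (p : ℝ) ≤ C0 * q ^ 4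
  hn0 : ∀ i, 0 < n i
  hn : ∀ i, |n i ^ 2 - q ^ 2| ≤ R * q
  htd : ∀ i, t i i = 1
  hts : ∀ i j, t i j = t j i
  hs : ∀ i j, i ≠ j → |n i * t i j| ≤ R
  hW : ∀ I J, HpBB t I J (2 * C1 * q ^ 2)

variable {q R C0 C1 : ℝ} {n : Fin p → ℝ} {t : Fin p → Fin p → ℝ}

lemma HpDet.q0 (h : HpDet p q R C0 C1 n t) : 0 < q := by linarith [h.hR, h.hq]

lemma HpDet.nsq (h : HpDet p q R C0 C1 n t) (i : Fin p) :
    q ^ 2 / 2 ≤ n i ^ 2 ∧ n i ^ 2 ≤ 2 * q ^ 2 := by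
  have h1 := abs_le.mp (h.hn i)
  have h2 := h.q0
  have h3 := h.hq
  constructor <;> nlinarith

lemma HpDet.nge (h : HpDet p q R C0 C1 n t) (i : Fin p) : q / 2 ≤ n i := by
  have h1 := (h.nsq i).1
  have h2 := h.q0
  have h3 := h.hn0 i
  by_contra hc
  push Not at hc
  nlinarith

lemma HpDet.ninv (h : HpDet p q R C0 C1 n t) (i : Fin p) (k : ℕ) :
    |(n i ^ k)⁻¹| ≤ (2 / q) ^ k := by
  have h1 := h.nge i
  have h2 := h.q0
  have h3 := h.hn0 i
  rw [abs_of_pos (by positivity), ← inv_pow]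
  refine pow_le_pow_left₀ (by positivity) ?_ k
  rw [inv_le_comm₀ h3 (by positivity), inv_div]
  exact h1

lemma HpDet.tle (h : HpDet p q R C0 C1 n t) (i j : Fin p) (hij : i ≠ j) : |t i j| ≤ 2 * R / q := by
  have h1 := h.nge i
  have h2 := h.q0
  have h3 := h.hs i j hij
  have h4 := h.hn0 i
  rw [abs_mul, abs_of_pos h4] at h3
  rw [le_div_iff₀ h2]
  nlinarith [abs_nonneg (t i j)]

lemma HpDet.tle1 (h : HpDet p q R C0 C1 n t) (i j : Fin p) : |t i j| ≤ 1 := by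
  by_cases hij : i = j
  · rw [hij, h.htd]; simp
  · refine (h.tle i j hij).trans ?_
    rw [div_le_one h.q0]; exact h.hq

/-- case `k ≥ 5` -/
lemma HpDet.big (h : HpDet p q R C0 C1 n t) (k : ℕ) (hk : 5 ≤ k) :
    HpBB (fun i j => t i j ^ k - (if i = j then 1 else 0)) Finset.univ Finset.univ
      (32 * C0 * R ^ 5 / q) := by
  have hq := h.q0
  have hR : 0 < R := by linarith [h.hR]
  have hC := h.hC0
  refine (hp_bb_entry ((2 * R / q) ^ 5) (by positivity) ?_).mono ?_
  · intro i _ j _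
    by_cases hij : i = j
    · simp only [hij, h.htd, if_true, one_pow, sub_self, abs_zero]; positivity
    · simp only [hij, if_false, sub_zero, abs_pow]
      calc |t i j| ^ k ≤ |t i j| ^ 5 := pow_le_pow_of_le_one (abs_nonneg _) (h.tle1 i j) hk
        _ ≤ _ := pow_le_pow_left₀ (abs_nonneg _) (h.tle i j hij) 5
  · calc (p : ℝ) * (2 * R / q) ^ 5 ≤ (C0 * q ^ 4) * (2 * R / q) ^ 5 := by
          have := h.hp
          gcongr
      _ = _ := by field_simp; ring

lemma hp_bb_of_sq {X : Fin p → Fin p → ℝ} {I J : Finset (Fin p)} {c : ℝ} (hc : 0 ≤ c)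
    (h : ∀ v : Fin p → ℝ, ∑ i ∈ I, (∑ j ∈ J, X i j * v j) ^ 2 ≤ c * ∑ j, v j ^ 2) :
    HpBB X I J (√c) := by
  intro u v
  have h1 := h fun j => if j ∈ J then v j else 0
  have e1 : ∑ j, (if j ∈ J then v j else 0) ^ 2 = ∑ j ∈ J, v j ^ 2 := by
    rw [← Finset.sum_filter_add_sum_filter_not Finset.univ (· ∈ J)]
    rw [Finset.sum_eq_zero (s := Finset.univ.filter (· ∉ J))]
    · simp only [Finset.filter_mem_eq_inter, Finset.univ_inter, add_zero]
      exact Finset.sum_congr rfl fun j hj => by simp [hj]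
    · intro j hj; simp at hj; simp [hj]
  have e2 : ∀ i, ∑ j ∈ J, X i j * (if j ∈ J then v j else 0) = ∑ j ∈ J, X i j * v j := fun i =>
    Finset.sum_congr rfl fun j hj => by simp [hj]
  simp only [e2, e1] at h1
  have h2 := Finset.sum_mul_sq_le_sq_mul_sq I u (fun i => ∑ j ∈ J, X i j * v j)
  have e3 : ∑ i ∈ I, ∑ j ∈ J, u i * X i j * v j = ∑ i ∈ I, u i * ∑ j ∈ J, X i j * v j := by
    simp only [Finset.mul_sum]
    exact Finset.sum_congr rfl fun i _ => Finset.sum_congr rfl fun j _ => by ring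
  rw [e3, ← Real.sqrt_mul hc, ← Real.sqrt_mul (mul_nonneg hc (hp_ssq_nonneg I u))]
  refine Real.abs_le_sqrt (h2.trans ?_)
  have := mul_le_mul_of_nonneg_left h1 (hp_ssq_nonneg I u)
  linarith

/-- The block hypothesis -/
def HpBlk (k : ℕ) (n : Fin p → ℝ) (t : Fin p → Fin p → ℝ) (b Q L : ℝ) : Prop :=
  ∀ x y z : ℕ, x ≤ y → y ≤ z → z ≤ p →
    (∀ v : Fin p → ℝ, ∑ j ∈ hpIv p y z, ∑ l ∈ hpIv p y z, v j * v l * hpCov k (t j l) ≤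
        Q * ∑ j, v j ^ 2) →
    (∀ i ∈ hpIv p x y, ∑ j ∈ hpIv p y z, hpPhi k (n i * t i j) ^ 2 ≤ b) →
    ∀ v : Fin p → ℝ, ∑ i ∈ hpIv p x y, (∑ j ∈ hpIv p y z, hpPhi k (n i * t i j) * v j) ^ 2 ≤
        Real.exp 1 * L * ∑ j, v j ^ 2

lemma HpDet.cb (h : HpDet p q R C0 C1 n t) (i : Fin p) : |3 / n i ^ 2 - 3 / q ^ 2| ≤ 6 * R / q ^ 3 := by
  have hq := h.q0
  have hn := h.hn0 i
  have h1 := h.hn i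
  have h2 := (h.nsq i).1
  have e : 3 / n i ^ 2 - 3 / q ^ 2 = - (3 * (n i ^ 2 - q ^ 2) / (n i ^ 2 * q ^ 2)) := by
    field_simp; ring
  rw [e, abs_neg, abs_div, abs_mul, abs_of_pos (show 0 < n i ^ 2 * q ^ 2 by positivity),
    abs_of_pos (show (0 : ℝ) < 3 by norm_num), div_le_div_iff₀ (by positivity) (by positivity)]
  have hR : 0 ≤ R := by linarith [h.hR]
  calc 3 * |n i ^ 2 - q ^ 2| * q ^ 3 ≤ 3 * (R * q) * q ^ 3 := by gcongr
    _ = 6 * R * (q ^ 2 / 2 * q ^ 2) := by ring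
    _ ≤ _ := by gcongr

lemma HpDet.cb4 (h : HpDet p q R C0 C1 n t) (i : Fin p) :
    |3 / n i ^ 4 - 3 / q ^ 4| ≤ 36 * R / q ^ 5 := by
  have hq := h.q0
  have hn := h.hn0 i
  have h1 := h.hn i
  obtain ⟨h2, h3⟩ := h.nsq i
  have hR : 0 ≤ R := by linarith [h.hR]
  have e : 3 / n i ^ 4 - 3 / q ^ 4 =
      (3 / n i ^ 2 - 3 / q ^ 2) * (1 / n i ^ 2 + 1 / q ^ 2) := by
    field_simp; ring
  rw [e, abs_mul, abs_of_pos (show 0 < 1 / n i ^ 2 + 1 / q ^ 2 by positivity)]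
  have h4 : 1 / n i ^ 2 ≤ 2 / q ^ 2 := by
    rw [div_le_div_iff₀ (by positivity) (by positivity)]; linarith
  calc _ ≤ 6 * R / q ^ 3 * (2 / q ^ 2 + 1 / q ^ 2) := by
        have := h.cb i
        gcongr
    _ = 18 * R / q ^ 5 := by field_simp; ring
    _ ≤ _ := by gcongr; norm_num

lemma HpDet.phib (h : HpDet p q R C0 C1 n t) (k : ℕ) (hk : k = 3 ∨ k = 4) (x y z : ℕ) (hxy : x ≤ y) :
    ∀ i ∈ hpIv p x y, ∑ j ∈ hpIv p y z, hpPhi k (n i * t i j) ^ 2 ≤ 16 * C0 * q ^ 4 * R ^ 8 := by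
  intro i hi
  have hR := h.hR
  have hq := h.q0
  have hC := h.hC0
  have hb : ∀ j ∈ hpIv p y z, hpPhi k (n i * t i j) ^ 2 ≤ 16 * R ^ 8 := by
    intro j hj
    have hij : i ≠ j := fun e => Finset.disjoint_left.mp (hp_iv_disj (p := p) x y z) hi (e ▸ hj)
    have hs := h.hs i j hij
    generalize n i * t i j = s at hs
    have h4 : s ^ 2 ≤ R ^ 2 := sq_le_sq' (abs_le.mp hs).1 (abs_le.mp hs).2
    have hR2 : 1 ≤ R ^ 2 := by nlinarith
    rcases hk with hk | hk
    · simp only [hpPhi, hk, if_true]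
      have e : (s ^ 3 - 3 * s) ^ 2 = s ^ 2 * (s ^ 2 - 3) ^ 2 := by ring
      rw [e]
      have h5 : (s ^ 2 - 3) ^ 2 ≤ (4 * R ^ 2) ^ 2 := by
        apply sq_le_sq' <;> nlinarith [sq_nonneg s]
      calc s ^ 2 * (s ^ 2 - 3) ^ 2 ≤ R ^ 2 * (4 * R ^ 2) ^ 2 := by gcongr
        _ = 16 * R ^ 6 := by ring
        _ ≤ 16 * R ^ 8 := by
            have := pow_le_pow_right₀ hR (show 6 ≤ 8 by norm_num)
            linarith
    · simp only [hpPhi, hk]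
      norm_num
      have h6 : s ^ 4 ≤ R ^ 4 := by
        have : (s ^ 2) ^ 2 ≤ (R ^ 2) ^ 2 := pow_le_pow_left₀ (sq_nonneg s) h4 2
        nlinarith
      have h7 : 1 ≤ R ^ 4 := one_le_pow₀ hR
      have h5 : (s ^ 4 - 3) ^ 2 ≤ (4 * R ^ 4) ^ 2 := by
        apply sq_le_sq' <;> nlinarith [sq_nonneg (s ^ 2)]
      calc _ ≤ _ := h5
        _ = _ := by ring
  calc _ ≤ ∑ j ∈ hpIv p y z, 16 * R ^ 8 := Finset.sum_le_sum hb
    _ = ((hpIv p y z).card : ℝ) * (16 * R ^ 8) := by simp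
    _ ≤ (C0 * q ^ 4) * (16 * R ^ 8) := by
        have : ((hpIv p y z).card : ℝ) ≤ p := by
          have := Finset.card_le_univ (hpIv p y z)
          simp at this; exact_mod_cast this
        have := this.trans h.hp
        gcongr
    _ = _ := by ring

/-- case `k = 4`, block -/
lemma HpDet.four (h : HpDet p q R C0 C1 n t) (Λ : ℝ) (hΛ : 0 ≤ Λ) (m : ℕ) (hm : p ≤ 2 ^ m)
    (hblk : HpBlk 4 n t (16 * C0 * q ^ 4 * R ^ 8) (96 + 384 * C0 * R ^ 2 * q ^ 2) (Λ * q ^ 6)) :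
    HpBB (fun i j => t i j ^ 4 - (if i = j then 1 else 0) - 3 / q ^ 4) Finset.univ Finset.univ
      (m * ((16 * √(Real.exp 1 * Λ) + 36 * C0 * R) / q) + 3 / q ^ 4) := by
  have hR := h.hR
  have hq := h.q0
  have hC := h.hC0
  set H : Fin p → Fin p → ℝ := fun i j => if i = j then 0 else t i j ^ 4 - 3 / q ^ 4 with hH
  have hd := hp_dyadic H (by
      intro i j; simp only [hH, h.hts i j, eq_comm]) (by intro i; simp [hH])
    ((16 * √(Real.exp 1 * Λ) + 36 * C0 * R) / q) (by positivity) m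
    (by
      intro s hs x y z hxy hyz hz _
      have hb := hblk x y z hxy hyz hz ?_ (h.phib 4 (Or.inr rfl) x y z hxy)
      · have h1 := hp_bb_of_sq (by positivity) hb
        have h2 := h1.row (Real.sqrt_nonneg _) (fun i => (n i ^ 4)⁻¹) ((2 / q) ^ 4) (by positivity)
          fun i _ => h.ninv i 4
        have h3 : HpBB (fun i j => 3 / n i ^ 4 - 3 / q ^ 4) (hpIv p x y) (hpIv p y z)
            (p * (36 * R / q ^ 5)) := hp_bb_entry _ (by positivity) fun i _ j _ => h.cb4 i
        refine ((h2.add h3).congr ?_).mono ?_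
        · intro i hi j hj
          have hij : i ≠ j := fun e => Finset.disjoint_left.mp (hp_iv_disj (p := p) x y z) hi (e ▸ hj)
          have := h.hn0 i
          simp only [hH, hij, if_false, hpPhi]
          norm_num
          field_simp
          ring
        · have e : √(Real.exp 1 * (Λ * q ^ 6)) = √(Real.exp 1 * Λ) * q ^ 3 := by
            rw [← mul_assoc, Real.sqrt_mul (by positivity), show q ^ 6 = (q ^ 3) ^ 2 by ring,
              Real.sqrt_sq (by positivity)]
          rw [e]
          have h4 : (p : ℝ) * (36 * R / q ^ 5) ≤ (C0 * q ^ 4) * (36 * R / q ^ 5) := by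
            have := h.hp
            gcongr
          have e2 : (C0 * q ^ 4) * (36 * R / q ^ 5) = 36 * C0 * R / q := by field_simp
          have e3 : (2 / q) ^ 4 * (√(Real.exp 1 * Λ) * q ^ 3) = 16 * √(Real.exp 1 * Λ) / q := by
            field_simp; norm_num; ring
          rw [e3, add_div]; linarith
      · intro v
        have h1 := hp_bb_diag (hpIv p y z) 96 96 (by norm_num)
        have h2 : HpBB (fun i j => hpCov 4 (t i j) - if i = j then 96 else 0) (hpIv p y z) (hpIv p y z)
            (p * (96 * (2 * R / q) ^ 2)) := by
          refine hp_bb_entry _ (by positivity) fun i _ j _ => ?_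
          by_cases hij : i = j
          · simp only [hij, h.htd, hpCov]
            norm_num; positivity
          · simp only [hpCov, hij]
            norm_num
            have h3 := h.tle i j hij
            have h4 := h.tle1 i j
            have h5 : t i j ^ 2 ≤ (2 * R / q) ^ 2 := sq_le_sq' (by linarith [abs_le.mp h3]) (abs_le.mp h3).2
            have h6 : t i j ^ 2 ≤ 1 := by rw [← sq_abs]; exact pow_le_one₀ (abs_nonneg _) h4
            rw [abs_of_nonneg (by positivity)]
            nlinarith [sq_nonneg (t i j)]
        have h3 := ((h1.add h2) v v)
        have e : ∑ i ∈ hpIv p y z, ∑ j ∈ hpIv p y z,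
            v i * ((if i = j then 96 else 0) + (hpCov 4 (t i j) - if i = j then 96 else 0)) * v j =
            ∑ i ∈ hpIv p y z, ∑ j ∈ hpIv p y z, v i * v j * hpCov 4 (t i j) :=
          Finset.sum_congr rfl fun i _ => Finset.sum_congr rfl fun j _ => by ring
        rw [e] at h3
        refine (le_abs_self _).trans (h3.trans ?_)
        rw [mul_assoc, Real.mul_self_sqrt (hp_ssq_nonneg _ v)]
        have h4 : ∑ i ∈ hpIv p y z, v i ^ 2 ≤ ∑ i, v i ^ 2 :=
          Finset.sum_le_sum_of_subset_of_nonneg (Finset.subset_univ _) fun _ _ _ => sq_nonneg _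
        have h5 : (96 + (p : ℝ) * (96 * (2 * R / q) ^ 2)) ≤ 96 + 384 * C0 * R ^ 2 * q ^ 2 := by
          calc _ ≤ 96 + (C0 * q ^ 4) * (96 * (2 * R / q) ^ 2) := by
                have := h.hp
                gcongr
            _ = _ := by field_simp; ring
        exact mul_le_mul h5 h4 (hp_ssq_nonneg _ v) (by positivity)) m le_rfl 0 p (by omega) le_rfl
      (by simpa using hm)
  have hu : hpIv p 0 p = Finset.univ := by
    ext i; simp [hpIv]
  rw [hu] at hd
  have h2 := hp_bb_diag (p := p) Finset.univ (-(3 / q ^ 4)) (3 / q ^ 4)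
    (by rw [abs_neg, abs_of_pos (by positivity)])
  refine (hd.add h2).congr ?_
  intro i _ j _
  by_cases hij : i = j
  · simp [hH, hij, h.htd]
  · simp [hH, hij]

/-- case `k = 3`, block -/
lemma HpDet.three (h : HpDet p q R C0 C1 n t) (Λ : ℝ) (hΛ : 0 ≤ Λ) (m : ℕ) (hm : p ≤ 2 ^ m)
    (hsmall : m * ((8 * √(Real.exp 1 * Λ) + 12 * C1 * R) / q) ≤ 1)
    (hblk : HpBlk 3 n t (16 * C0 * q ^ 4 * R ^ 8) (6 * (2 + 6 * C1)) (Λ * q ^ 4)) :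
    HpBB (fun i j => t i j ^ 3 - (if i = j then 1 else 0) - 3 / q ^ 2 * t i j)
      Finset.univ Finset.univ
      (m * ((8 * √(Real.exp 1 * Λ) + 12 * C1 * R) / q) + 3 / q ^ 2) := by
  have hR := h.hR
  have hq := h.q0
  have hC := h.hC0
  have hC1 := h.hC1
  set β := (8 * √(Real.exp 1 * Λ) + 12 * C1 * R) / q with hβ
  have hβ0 : 0 ≤ β := by positivity
  set H : Fin p → Fin p → ℝ := fun i j => if i = j then 0 else t i j ^ 3 - 3 / q ^ 2 * t i j with hH
  have hd := hp_dyadic H (by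
      intro i j; simp only [hH, h.hts i j, eq_comm]) (by intro i; simp [hH])
    β (by positivity) m
    (by
      intro s hs x y z hxy hyz hz hih
      have hb := hblk x y z hxy hyz hz ?_ (h.phib 3 (Or.inl rfl) x y z hxy)
      · have h1 := hp_bb_of_sq (by positivity) hb
        have h2 := h1.row (Real.sqrt_nonneg _) (fun i => (n i ^ 3)⁻¹) ((2 / q) ^ 3) (by positivity)
          fun i _ => h.ninv i 3
        have h3 := (h.hW (hpIv p x y) (hpIv p y z)).row (by positivity)
          (fun i => 3 / n i ^ 2 - 3 / q ^ 2) (6 * R / q ^ 3) (by positivity) fun i _ => h.cb i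
        refine ((h2.add h3).congr ?_).mono ?_
        · intro i hi j hj
          have hij : i ≠ j := fun e => Finset.disjoint_left.mp (hp_iv_disj (p := p) x y z) hi (e ▸ hj)
          have := h.hn0 i
          simp only [hH, hij, if_false, hpPhi, if_true]
          field_simp
          ring
        · have e : √(Real.exp 1 * (Λ * q ^ 4)) = √(Real.exp 1 * Λ) * q ^ 2 := by
            rw [← mul_assoc, Real.sqrt_mul (by positivity), show q ^ 4 = (q ^ 2) ^ 2 by ring,
              Real.sqrt_sq (by positivity)]
          rw [e, hβ]
          apply le_of_eq
          field_simp
          ring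
      · intro v
        have h1 := hp_bb_diag (hpIv p y z) (1 - 3 / q ^ 2) 1 (by
          have : 3 / q ^ 2 ≤ 1 := by rw [div_le_one (by positivity)]; nlinarith [h.hq]
          have : 0 < 3 / q ^ 2 := by positivity
          rw [abs_le]; constructor <;> linarith)
        have h2 := (h.hW (hpIv p y z) (hpIv p y z)).smul (3 / q ^ 2) (by positivity)
        have h3 := ((((h1.add h2).add hih)).smul 6 (by norm_num)) v v
        have e : ∑ i ∈ hpIv p y z, ∑ j ∈ hpIv p y z,
            v i * (6 * (((if i = j then 1 - 3 / q ^ 2 else 0) + 3 / q ^ 2 * t i j) + H i j)) * v j =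
            ∑ i ∈ hpIv p y z, ∑ j ∈ hpIv p y z, v i * v j * hpCov 3 (t i j) :=
          Finset.sum_congr rfl fun i _ => Finset.sum_congr rfl fun j _ => by
            by_cases hij : i = j
            · simp [hij, hH, hpCov, h.htd]; ring
            · simp [hij, hH, hpCov]; ring
        rw [e] at h3
        refine (le_abs_self _).trans (h3.trans ?_)
        rw [mul_assoc, Real.mul_self_sqrt (hp_ssq_nonneg _ v)]
        have h4 : ∑ i ∈ hpIv p y z, v i ^ 2 ≤ ∑ i, v i ^ 2 :=
          Finset.sum_le_sum_of_subset_of_nonneg (Finset.subset_univ _) fun _ _ _ => sq_nonneg _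
        have h6 : (s : ℝ) * β ≤ 1 := by
          refine le_trans ?_ hsmall
          have : (s : ℝ) ≤ m := by exact_mod_cast hs
          gcongr
        have h5 : 6 * (1 + 3 / q ^ 2 * (2 * C1 * q ^ 2) + s * β) ≤ 6 * (2 + 6 * C1) := by
          have : 3 / q ^ 2 * (2 * C1 * q ^ 2) = 6 * C1 := by field_simp; ring
          rw [this]; linarith
        exact mul_le_mul h5 h4 (hp_ssq_nonneg _ v) (by positivity)) m le_rfl 0 p (by omega) le_rfl
      (by simpa using hm)
  have hu : hpIv p 0 p = Finset.univ := by
    ext i; simp [hpIv]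
  rw [hu] at hd
  have h2 := hp_bb_diag (p := p) Finset.univ (-(3 / q ^ 2)) (3 / q ^ 2)
    (by rw [abs_neg, abs_of_pos (by positivity)])
  refine (hd.add h2).congr ?_
  intro i _ j _
  by_cases hij : i = j
  · simp [hH, hij, h.htd]
  · simp [hH, hij]

end Deterministic
section Assemble

variable {p d : ℕ}

lemma hp_enorm_sq {ι : Type*} [Fintype ι] (x : ι → ℝ) : enorm2 x ^ 2 = ∑ i, x i ^ 2 :=
  Real.sq_sqrt (Finset.sum_nonneg fun _ _ => sq_nonneg _)

lemma hp_dotp_N {ι : Type*} [Fintype ι] (x y : ι → ℝ) : dotp (hpN x) y = (enorm2 x)⁻¹ * dotp x y := by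
  simp only [dotp, hpN, Pi.smul_apply, smul_eq_mul, Finset.mul_sum, mul_assoc]

lemma hp_dotp_comm {ι : Type*} [Fintype ι] (x y : ι → ℝ) : dotp x y = dotp y x := by
  simp only [dotp, mul_comm]

lemma hp_dual (C1 : ℝ) (hC1 : 0 < C1) (hd : 1 ≤ d) (ω : Fin p → Fin d → ℝ)
    (hn : ∀ i, (d : ℝ) / 2 ≤ enorm2 (ω i) ^ 2)
    (h3 : ∀ v : Fin d → ℝ, ∑ i, (dotp (ω i) v) ^ 2 ≤ C1 * d ^ 2 * ∑ j, v j ^ 2)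
    (J : Finset (Fin p)) (v : Fin p → ℝ) :
    ∑ l, (∑ j ∈ J, v j * hpN (ω j) l) ^ 2 ≤ 2 * C1 * d * ∑ j ∈ J, v j ^ 2 := by
  have hd0 : (0 : ℝ) < d := by exact_mod_cast hd
  set y : Fin d → ℝ := fun l => ∑ j ∈ J, v j * hpN (ω j) l with hy
  set V := ∑ j ∈ J, v j ^ 2 with hV
  have hV0 : 0 ≤ V := hp_ssq_nonneg J v
  change ∑ l, y l ^ 2 ≤ _
  set Y := ∑ l, y l ^ 2 with hY
  have hY0 : 0 ≤ Y := Finset.sum_nonneg fun _ _ => sq_nonneg _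
  have e : Y = ∑ j ∈ J, v j * dotp (hpN (ω j)) y := by
    have : ∀ l, y l ^ 2 = ∑ j ∈ J, v j * hpN (ω j) l * y l := by
      intro l; rw [← Finset.sum_mul, sq]
    simp only [hY, this, dotp, Finset.mul_sum]
    rw [Finset.sum_comm]
    exact Finset.sum_congr rfl fun j _ => Finset.sum_congr rfl fun l _ => by ring
  have h1 := Finset.sum_mul_sq_le_sq_mul_sq J v (fun j => dotp (hpN (ω j)) y)
  rw [← e] at h1
  have h2 : ∑ j ∈ J, dotp (hpN (ω j)) y ^ 2 ≤ 2 / d * (C1 * d ^ 2 * Y) := by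
    calc ∑ j ∈ J, dotp (hpN (ω j)) y ^ 2 ≤ ∑ j, dotp (hpN (ω j)) y ^ 2 :=
          Finset.sum_le_sum_of_subset_of_nonneg (Finset.subset_univ _) fun _ _ _ => sq_nonneg _
      _ ≤ ∑ j, 2 / d * dotp (ω j) y ^ 2 := by
          refine Finset.sum_le_sum fun j _ => ?_
          rw [hp_dotp_N, mul_pow, inv_pow]
          refine mul_le_mul_of_nonneg_right ?_ (sq_nonneg _)
          have := hn j
          rw [← inv_div]
          exact inv_anti₀ (by positivity) this
      _ = 2 / d * ∑ j, dotp (ω j) y ^ 2 := by rw [Finset.mul_sum]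
      _ ≤ _ := mul_le_mul_of_nonneg_left (h3 y) (by positivity)
  have h4 : Y ^ 2 ≤ V * (2 / d * (C1 * d ^ 2 * Y)) := h1.trans (mul_le_mul_of_nonneg_left h2 hV0)
  have h5 : V * (2 / d * (C1 * d ^ 2 * Y)) = (2 * C1 * d * V) * Y := by field_simp
  rw [h5, sq] at h4
  rcases hY0.eq_or_lt with h0 | h0
  · rw [← h0]; positivity
  · exact le_of_mul_le_mul_right h4 h0

lemma hp_W (C1 : ℝ) (hC1 : 0 < C1) (hd : 1 ≤ d) (ω : Fin p → Fin d → ℝ)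
    (hn : ∀ i, (d : ℝ) / 2 ≤ enorm2 (ω i) ^ 2)
    (h3 : ∀ v : Fin d → ℝ, ∑ i, (dotp (ω i) v) ^ 2 ≤ C1 * d ^ 2 * ∑ j, v j ^ 2)
    (I J : Finset (Fin p)) :
    HpBB (fun i j => dotp (hpN (ω i)) (hpN (ω j))) I J (2 * C1 * d) := by
  intro u v
  have h1 := hp_dual C1 hC1 hd ω hn h3 I u
  have h2 := hp_dual C1 hC1 hd ω hn h3 J v
  have e : ∑ i ∈ I, ∑ j ∈ J, u i * dotp (hpN (ω i)) (hpN (ω j)) * v j =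
      ∑ l, (∑ i ∈ I, u i * hpN (ω i) l) * (∑ j ∈ J, v j * hpN (ω j) l) := by
    simp only [dotp, Finset.mul_sum, Finset.sum_mul]
    have : ∀ i ∈ I, ∑ j ∈ J, ∑ l, u i * (hpN (ω i) l * hpN (ω j) l) * v j =
        ∑ l, ∑ j ∈ J, u i * (hpN (ω i) l * hpN (ω j) l) * v j := fun i _ => Finset.sum_comm
    rw [Finset.sum_congr rfl this, Finset.sum_comm]
    refine Finset.sum_congr rfl fun l _ => ?_
    rw [Finset.sum_comm]
    exact Finset.sum_congr rfl fun i _ => Finset.sum_congr rfl fun j _ => by ring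
  rw [e]
  have h3 := Finset.sum_mul_sq_le_sq_mul_sq Finset.univ (fun l => ∑ i ∈ I, u i * hpN (ω i) l)
    (fun l => ∑ j ∈ J, v j * hpN (ω j) l)
  have hd0 : (0 : ℝ) < d := by exact_mod_cast hd
  have hU := hp_ssq_nonneg I u
  have hV := hp_ssq_nonneg J v
  rw [mul_assoc, ← Real.sqrt_mul hU]
  have : 2 * C1 * d = √((2 * C1 * d) ^ 2) := (Real.sqrt_sq (by positivity)).symm
  rw [this, ← Real.sqrt_mul (sq_nonneg _)]
  refine Real.abs_le_sqrt (h3.trans ?_)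
  calc _ ≤ (2 * C1 * d * ∑ j ∈ I, u j ^ 2) * (2 * C1 * d * ∑ j ∈ J, v j ^ 2) :=
        mul_le_mul h1 h2 (Finset.sum_nonneg fun _ _ => sq_nonneg _) (by positivity)
    _ = _ := by ring

/-- constants -/
def hpC1 (C0 : ℝ) : ℝ := Real.exp 1 * (Real.exp 1 * C0 + 1)

/-- constants -/
def hpL3 (C0 R : ℝ) : ℝ := Real.exp 1 * C0 * (6 * (2 + 6 * hpC1 C0)) + 16 * C0 * R ^ 9

/-- constants -/
def hpL4 (C0 R : ℝ) : ℝ := Real.exp 1 * C0 * (96 + 384 * C0 * R ^ 2) + 16 * C0 * R ^ 9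

/-- The good event. -/
def HpGood (C0 R : ℝ) (ω : Fin p → Fin d → ℝ) : Prop :=
  HpDet p (√d) R C0 (hpC1 C0) (fun i => enorm2 (ω i)) (fun i j => dotp (hpN (ω i)) (hpN (ω j))) ∧
  HpBlk 3 (fun i => enorm2 (ω i)) (fun i j => dotp (hpN (ω i)) (hpN (ω j)))
    (16 * C0 * √d ^ 4 * R ^ 8) (6 * (2 + 6 * hpC1 C0)) (hpL3 C0 R * √d ^ 4) ∧
  HpBlk 4 (fun i => enorm2 (ω i)) (fun i j => dotp (hpN (ω i)) (hpN (ω j)))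
    (16 * C0 * √d ^ 4 * R ^ 8) (96 + 384 * C0 * R ^ 2 * √d ^ 2) (hpL4 C0 R * √d ^ 6)

/-- block bad event -/
def hpBadBlk (p d k : ℕ) (b Q L : ℝ) (x y z : ℕ) : Set (Fin p → Fin d → ℝ) := {ω |
      (∀ j, ∑ i, hpN (ω j) i ^ 2 = 1) ∧
      (∀ v : Fin p → ℝ, ∑ j ∈ hpIv p y z, ∑ l ∈ hpIv p y z,
        v j * v l * hpCov k (dotp (hpN (ω j)) (hpN (ω l))) ≤ Q * ∑ j, v j ^ 2) ∧
      (∀ i ∈ hpIv p x y, ∑ j ∈ hpIv p y z, hpPhi k (dotp (ω i) (hpN (ω j))) ^ 2 ≤ b) ∧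
      ¬ ∀ v : Fin p → ℝ, ∑ i ∈ hpIv p x y, (∑ j ∈ hpIv p y z,
        hpPhi k (dotp (ω i) (hpN (ω j))) * v j) ^ 2 ≤ Real.exp 1 * L * ∑ j, v j ^ 2}

/-- union of block bad events -/
def hpBadBlks (p d k : ℕ) (b Q L : ℝ) : Set (Fin p → Fin d → ℝ) :=
  ⋃ x : Fin (p + 1), ⋃ y : Fin (p + 1), ⋃ z : Fin (p + 1), hpBadBlk p d k b Q L x y z

lemma hp_union_le {Ω : Type*} [MeasurableSpace Ω] (P : Measure Ω) (N : ℕ) (s : Fin N → Set Ω) (c : ℝ)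
    (hc : 0 ≤ c) (h : ∀ i, P (s i) ≤ ENNReal.ofReal c) : P (⋃ i, s i) ≤ ENNReal.ofReal (N * c) := by
  calc P (⋃ i, s i) ≤ ∑ i, P (s i) := measure_iUnion_fintype_le P s
    _ ≤ ∑ i : Fin N, ENNReal.ofReal c := Finset.sum_le_sum fun i _ => h i
    _ = _ := by
      rw [Finset.sum_const, Finset.card_univ, Fintype.card_fin, nsmul_eq_mul,
        ENNReal.ofReal_mul (Nat.cast_nonneg N), ENNReal.ofReal_natCast]

lemma hp_badblks (k : ℕ) (b Q L : ℝ) (hb0 : 0 < b) (hQ0 : 0 ≤ Q) (n : ℕ) (hn : 0 < n)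
    (hL1 : Real.exp 1 * p * Q ≤ L) (hL2 : n * b ≤ L) :
    (Measure.pi fun _ : Fin p => stdG (Fin d)) (hpBadBlks p d k b Q L) ≤
      ENNReal.ofReal ((p + 1) ^ 3 * ((p + p * n) * Real.exp (-n))) := by
  have h0 : 0 ≤ (p + p * n : ℝ) * Real.exp (-n) := by positivity
  have h := hp_union_le (Measure.pi fun _ : Fin p => stdG (Fin d)) (p + 1) _ _ (by positivity) fun x =>
    hp_union_le (Measure.pi fun _ : Fin p => stdG (Fin d)) (p + 1) _ _ (by positivity) fun y =>
      hp_union_le (Measure.pi fun _ : Fin p => stdG (Fin d)) (p + 1)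
        (fun z => hpBadBlk p d k b Q L x y z) _ h0 fun z =>
        hp_block k b Q L hb0 hQ0 n hn (hpIv p x y) (hpIv p y z) (hp_iv_disj _ _ _) hL1 hL2
  refine h.trans (ENNReal.ofReal_le_ofReal (le_of_eq ?_))
  push_cast; ring

lemma hp_blk_of (k : ℕ) (b Q L : ℝ) (ω : Fin p → Fin d → ℝ) (hn0 : ∀ i, 0 < enorm2 (ω i))
    (h1 : ∀ j, ∑ i, hpN (ω j) i ^ 2 = 1) (hω : ω ∉ hpBadBlks p d k b Q L) :
    HpBlk k (fun i => enorm2 (ω i)) (fun i j => dotp (hpN (ω i)) (hpN (ω j))) b Q L := by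
  intro x y z hxy hyz hz h2 h3
  have e : ∀ i j, enorm2 (ω i) * dotp (hpN (ω i)) (hpN (ω j)) = dotp (ω i) (hpN (ω j)) := by
    intro i j
    rw [hp_dotp_N, ← mul_assoc, mul_inv_cancel₀ (hn0 i).ne', one_mul]
  simp only [e] at h3 ⊢
  by_contra hc
  apply hω
  simp only [hpBadBlks, Set.mem_iUnion]
  exact ⟨⟨x, by omega⟩, ⟨y, by omega⟩, ⟨z, by omega⟩, h1, h2, h3, hc⟩

lemma hp_good_prob (C0 : ℝ) (hC0 : 0 < C0) (hd : 1 ≤ d) (m : ℕ) (hm : 1 ≤ m)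
    (hmd : 8 * (m : ℝ) ≤ √d) (hp : (p : ℝ) ≤ C0 * d ^ 2) :
    (Measure.pi fun _ : Fin p => stdG (Fin d)) {ω | ¬ HpGood C0 (4 * m) ω} ≤
      ENNReal.ofReal (12 * (p + 1) ^ 4 * (d + 1) * (m + 1) * Real.exp (-m)) := by
  set P := (Measure.pi fun _ : Fin p => stdG (Fin d)) with hP
  set q := √(d : ℝ) with hq
  have hd0 : (0 : ℝ) < d := by exact_mod_cast hd
  have hq2 : q ^ 2 = d := Real.sq_sqrt hd0.le
  have hm1 : (1 : ℝ) ≤ m := by exact_mod_cast hm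
  have hq8 : 8 ≤ q := by linarith
  have he := Real.exp_pos 1
  have hC1 : 0 < hpC1 C0 := by unfold hpC1; positivity
  set R : ℝ := 4 * m with hR
  have hpq : (p : ℝ) ≤ C0 * q ^ 4 := by
    have : q ^ 4 = (d : ℝ) ^ 2 := by rw [← hq2]; ring
    rw [this]; exact hp
  have hmR : (m : ℝ) ≤ R := by rw [hR]; linarith
  have hR1 : 1 ≤ R := by linarith
  set b := 16 * C0 * q ^ 4 * R ^ 8 with hb
  have hb0 : 0 < b := by positivity
  have hmb : m * b ≤ 16 * C0 * R ^ 9 * q ^ 4 := by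
    rw [hb]
    calc m * (16 * C0 * q ^ 4 * R ^ 8) ≤ R * (16 * C0 * q ^ 4 * R ^ 8) := by gcongr
      _ = _ := by ring
  set B1 : Set (Fin p → Fin d → ℝ) := ⋃ i, {ω | 4 * m * √d < |∑ l, ω i l ^ 2 - d|} with hB1
  set B2 : Set (Fin p → Fin d → ℝ) := ⋃ i, ⋃ j, {ω | i ≠ j ∧ R < |dotp (ω i) (hpN (ω j))|} with hB2
  set B3 : Set (Fin p → Fin d → ℝ) := {ω | (∀ i, ∑ l, ω i l ^ 2 ≤ 2 * d) ∧
      ¬ ∀ v : Fin d → ℝ, ∑ i, (dotp (ω i) v) ^ 2 ≤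
        Real.exp 1 * ((Real.exp 1 * C0 + 1) * d ^ 2) * ∑ j, v j ^ 2} with hB3
  set B4 := hpBadBlks p d 3 b (6 * (2 + 6 * hpC1 C0)) (hpL3 C0 R * q ^ 4) with hB4
  set B5 := hpBadBlks p d 4 b (96 + 384 * C0 * R ^ 2 * q ^ 2) (hpL4 C0 R * q ^ 6) with hB5
  have hsub : {ω | ¬ HpGood C0 R ω} ⊆ (((B1 ∪ B2) ∪ B3) ∪ B4) ∪ B5 := by
    intro ω hω
    by_contra hc
    simp only [Set.mem_union, not_or] at hc
    obtain ⟨⟨⟨⟨n1, n2⟩, n3⟩, n4⟩, n5⟩ := hc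
    apply hω
    have g1 : ∀ i, |enorm2 (ω i) ^ 2 - q ^ 2| ≤ R * q := by
      intro i
      by_contra hcc
      apply n1
      push Not at hcc
      rw [hq2, hp_enorm_sq] at hcc
      exact Set.mem_iUnion.mpr ⟨i, hcc⟩
    have g1' : ∀ i, q ^ 2 / 2 ≤ enorm2 (ω i) ^ 2 ∧ enorm2 (ω i) ^ 2 ≤ 2 * q ^ 2 := by
      intro i
      have := abs_le.mp (g1 i)
      have h2 : R * q ≤ q ^ 2 / 2 := by nlinarith
      constructor <;> linarith
    have hn0 : ∀ i, 0 < enorm2 (ω i) := by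
      intro i
      have h1 := (g1' i).1
      have h2 : 0 ≤ enorm2 (ω i) := Real.sqrt_nonneg _
      rcases h2.eq_or_lt with h | h
      · rw [← h] at h1; nlinarith
      · exact h
    have hunit : ∀ j, ∑ i, hpN (ω j) i ^ 2 = 1 := by
      intro j
      simp only [hpN, Pi.smul_apply, smul_eq_mul, mul_pow, ← Finset.mul_sum]
      rw [← hp_enorm_sq, ← mul_pow, inv_mul_cancel₀ (hn0 j).ne', one_pow]
    have g2 : ∀ i j, i ≠ j → |dotp (ω i) (hpN (ω j))| ≤ R := by
      intro i j hij
      by_contra hcc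
      apply n2
      push Not at hcc
      simp only [hB2, Set.mem_iUnion]
      exact ⟨i, j, hij, hcc⟩
    have g3 : ∀ v : Fin d → ℝ, ∑ i, (dotp (ω i) v) ^ 2 ≤ hpC1 C0 * d ^ 2 * ∑ j, v j ^ 2 := by
      by_contra hcc
      apply n3
      refine ⟨fun i => ?_, ?_⟩
      · rw [← hp_enorm_sq, ← hq2]; exact (g1' i).2
      · intro hall; apply hcc; intro v
        refine (hall v).trans (le_of_eq ?_)
        unfold hpC1; ring
    refine ⟨?_, ?_, ?_⟩
    · refine ⟨hR1, by linarith, hC0, hC1, hpq, hn0, g1, ?_, ?_, ?_, ?_⟩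
      · intro i
        rw [← hunit i]; simp only [dotp, sq]
      · intro i j; exact hp_dotp_comm _ _
      · intro i j hij
        rw [hp_dotp_N, ← mul_assoc, mul_inv_cancel₀ (hn0 i).ne', one_mul]
        exact g2 i j hij
      · intro I J
        have := hp_W (hpC1 C0) hC1 hd ω (fun i => by rw [← hq2]; exact (g1' i).1) g3 I J
        rw [hq2]; exact this
    · exact hp_blk_of 3 _ _ _ ω hn0 hunit n4
    · exact hp_blk_of 4 _ _ _ ω hn0 hunit n5
  have p1 : P B1 ≤ ENNReal.ofReal (p * (4 * Real.exp (-m))) :=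
    hp_union_le P p _ _ (by positivity) fun i => hp_G1 hd m i
  have p2 : P B2 ≤ ENNReal.ofReal (p * (p * (4 * Real.exp (-m)))) := by
    refine hp_union_le P p _ _ (by positivity) fun i => hp_union_le P p _ _ (by positivity) fun j => ?_
    by_cases hij : i = j
    · simp [hij]
    · simp only [ne_eq, hij, not_false_eq_true, true_and]
      refine (hp_G2 R i j hij).trans (ENNReal.ofReal_le_ofReal ?_)
      have : Real.exp (-R) ≤ Real.exp (-m) := Real.exp_le_exp.mpr (by linarith)
      linarith
  have p3 : P B3 ≤ ENNReal.ofReal ((d + p * m) * Real.exp (-m)) := by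
    refine hp_G3 (2 * d) _ (by positivity) m (by omega) ?_ ?_
    · nlinarith
    · have h1 : (2 * m : ℝ) ≤ d := by nlinarith
      have h2 : 0 ≤ Real.exp 1 * C0 * d ^ 2 := by positivity
      nlinarith
  have p4 : P B4 ≤ ENNReal.ofReal ((p + 1) ^ 3 * ((p + p * m) * Real.exp (-m))) := by
    refine hp_badblks 3 b _ _ hb0 (by positivity) m (by omega) ?_ ?_
    · unfold hpL3
      calc Real.exp 1 * p * (6 * (2 + 6 * hpC1 C0)) ≤
          Real.exp 1 * (C0 * q ^ 4) * (6 * (2 + 6 * hpC1 C0)) := by gcongr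
        _ ≤ Real.exp 1 * (C0 * q ^ 4) * (6 * (2 + 6 * hpC1 C0)) + 16 * C0 * R ^ 9 * q ^ 4 :=
          le_add_of_nonneg_right (by positivity)
        _ = _ := by ring
    · refine hmb.trans ?_
      unfold hpL3
      rw [add_mul]
      exact le_add_of_nonneg_left (by positivity)
  have p5 : P B5 ≤ ENNReal.ofReal ((p + 1) ^ 3 * ((p + p * m) * Real.exp (-m))) := by
    have hq1 : 1 ≤ q := by linarith
    have hq12 : 1 ≤ q ^ 2 := one_le_pow₀ hq1
    refine hp_badblks 4 b _ _ hb0 (by positivity) m (by omega) ?_ ?_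
    · unfold hpL4
      calc Real.exp 1 * p * (96 + 384 * C0 * R ^ 2 * q ^ 2) ≤
          Real.exp 1 * (C0 * q ^ 4) * (96 * q ^ 2 + 384 * C0 * R ^ 2 * q ^ 2) := by
            gcongr; linarith
        _ ≤ Real.exp 1 * (C0 * q ^ 4) * (96 * q ^ 2 + 384 * C0 * R ^ 2 * q ^ 2) +
            16 * C0 * R ^ 9 * q ^ 6 :=
          le_add_of_nonneg_right (by positivity)
        _ = _ := by ring
    · refine hmb.trans ?_
      unfold hpL4
      rw [add_mul]
      have : q ^ 4 ≤ q ^ 6 := pow_le_pow_right₀ hq1 (by norm_num)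
      calc 16 * C0 * R ^ 9 * q ^ 4 ≤ 16 * C0 * R ^ 9 * q ^ 6 := by gcongr
        _ ≤ _ := le_add_of_nonneg_left (by positivity)
  have hE := Real.exp_pos (-(m : ℝ))
  calc P {ω | ¬ HpGood C0 R ω} ≤ P ((((B1 ∪ B2) ∪ B3) ∪ B4) ∪ B5) := measure_mono hsub
    _ ≤ P B1 + P B2 + P B3 + P B4 + P B5 := by
        refine (measure_union_le _ _).trans (add_le_add ?_ le_rfl)
        refine (measure_union_le _ _).trans (add_le_add ?_ le_rfl)
        refine (measure_union_le _ _).trans (add_le_add ?_ le_rfl)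
        exact measure_union_le _ _
    _ ≤ _ := add_le_add (add_le_add (add_le_add (add_le_add p1 p2) p3) p4) p5
    _ = ENNReal.ofReal ((p * (4 * Real.exp (-m))) + (p * (p * (4 * Real.exp (-m)))) +
          ((d + p * m) * Real.exp (-m)) + ((p + 1) ^ 3 * ((p + p * m) * Real.exp (-m))) +
          ((p + 1) ^ 3 * ((p + p * m) * Real.exp (-m)))) := by
        rw [ENNReal.ofReal_add, ENNReal.ofReal_add, ENNReal.ofReal_add, ENNReal.ofReal_add] <;>
          positivity
    _ ≤ _ := by
        apply ENNReal.ofReal_le_ofReal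
        have e : (p * (4 * Real.exp (-m))) + (p * (p * (4 * Real.exp (-m)))) +
          ((d + p * m) * Real.exp (-m)) + ((p + 1) ^ 3 * ((p + p * m) * Real.exp (-m))) +
          ((p + 1) ^ 3 * ((p + p * m) * Real.exp (-m))) =
          (4 * p + 4 * p ^ 2 + d + p * m + 2 * (p + 1) ^ 3 * (p + p * m) : ℝ) * Real.exp (-m) := by
          ring
        rw [e]
        refine mul_le_mul_of_nonneg_right ?_ hE.le
        have hp0 : (0 : ℝ) ≤ p := Nat.cast_nonneg p
        have hm0 : (0 : ℝ) ≤ m := Nat.cast_nonneg m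
        generalize (p : ℝ) = x at hp0
        generalize (m : ℝ) = y at hm0
        generalize (d : ℝ) = z at hd0
        rw [← sub_nonneg]
        ring_nf
        positivity

end Assemble

section Final

/-- constant in the bound for `k = 3` -/
def hpc3 (C0 : ℝ) : ℝ := Real.exp 1 * C0 * (6 * (2 + 6 * hpC1 C0)) + 16 * C0
/-- constant in the bound for `k = 4` -/
def hpc4 (C0 : ℝ) : ℝ := Real.exp 1 * C0 * (96 + 384 * C0) + 16 * C0
/-- overall constant -/
def hpB (C0 : ℝ) : ℝ := (8 * (Real.exp 1 * hpc3 C0 + 1) + 12 * hpC1 C0 + 3) +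
  (16 * (Real.exp 1 * hpc4 C0 + 1) + 36 * C0 + 3) + 32 * C0

lemma hp_c1_pos {C0 : ℝ} (h : 0 < C0) : 0 < hpC1 C0 := by unfold hpC1; positivity
lemma hp_c3_pos {C0 : ℝ} (h : 0 < C0) : 0 < hpc3 C0 := by
  have := hp_c1_pos h
  unfold hpc3; positivity
lemma hp_c4_pos {C0 : ℝ} (h : 0 < C0) : 0 < hpc4 C0 := by unfold hpc4; positivity

lemma hp_sqrt_le (x : ℝ) (hx : 0 ≤ x) : √x ≤ x + 1 := by
  rw [Real.sqrt_le_left (by linarith)]; nlinarith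

lemma hp_l3 {C0 R : ℝ} (h : 0 < C0) (hR : 1 ≤ R) : 0 ≤ hpL3 C0 R ∧ hpL3 C0 R ≤ hpc3 C0 * R ^ 9 := by
  have := hp_c1_pos h
  have h9 : 1 ≤ R ^ 9 := one_le_pow₀ hR
  unfold hpL3 hpc3
  refine ⟨by positivity, ?_⟩
  rw [add_mul]
  exact add_le_add (le_mul_of_one_le_right (by positivity) h9) le_rfl

lemma hp_l4 {C0 R : ℝ} (h : 0 < C0) (hR : 1 ≤ R) : 0 ≤ hpL4 C0 R ∧ hpL4 C0 R ≤ hpc4 C0 * R ^ 9 := by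
  have h9 : 1 ≤ R ^ 9 := one_le_pow₀ hR
  have h29 : R ^ 2 ≤ R ^ 9 := pow_le_pow_right₀ hR (by norm_num)
  unfold hpL4 hpc4
  refine ⟨by positivity, ?_⟩
  rw [add_mul, mul_assoc (Real.exp 1 * C0)]
  gcongr
  nlinarith

/-- generic numeric bound -/
lemma hp_num (a c b Λ M R q : ℝ) (ha : 0 ≤ a) (hc : 0 ≤ c) (hb : 0 ≤ b) (hΛ : 0 ≤ Λ)
    (hΛc : Λ ≤ c * R ^ 9) (hR : 1 ≤ R) (hM : M ≤ R) (hM0 : 0 ≤ M) (hq : 0 < q) :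
    M * ((a * √(Real.exp 1 * Λ) + b * R) / q) + 3 / q ≤
      (a * (Real.exp 1 * c + 1) + b + 3) * R ^ 10 / q := by
  have h9 : 1 ≤ R ^ 9 := one_le_pow₀ hR
  have h10 : 1 ≤ R ^ 10 := one_le_pow₀ hR
  have h19 : R ≤ R ^ 9 := le_self_pow₀ hR (by norm_num)
  have hs : √(Real.exp 1 * Λ) ≤ (Real.exp 1 * c + 1) * R ^ 9 := by
    refine (hp_sqrt_le _ (by positivity)).trans ?_
    have : Real.exp 1 * Λ ≤ Real.exp 1 * (c * R ^ 9) := by gcongr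
    linarith
  rw [← mul_div_assoc, ← add_div]
  apply div_le_div_of_nonneg_right _ hq.le
  calc M * (a * √(Real.exp 1 * Λ) + b * R) + 3
      ≤ R * (a * ((Real.exp 1 * c + 1) * R ^ 9) + b * R ^ 9) + 3 * R ^ 10 := by
        refine add_le_add ?_ (by linarith)
        gcongr
    _ = _ := by ring

variable {p d : ℕ}

lemma hp_final_det (k : ℕ) (hk : 3 ≤ k) (C0 : ℝ) (hC0 : 0 < C0) (hd : 1 ≤ d) (m : ℕ) (hm : 1 ≤ m)
    (hpm : p ≤ 2 ^ m) (ω : Fin p → Fin d → ℝ) (hg : HpGood C0 (4 * m) ω) (β : ℝ)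
    (hβ : hpB C0 * (4 * (m : ℝ)) ^ 10 / √d ≤ β) (hβ1 : β ≤ 1) :
    (k = 3 →
      opNorm (fun i j : Fin p =>
        (dotp (hpN (ω i)) (hpN (ω j))) ^ k - (if i = j then 1 else 0) -
          (3 / (d : ℝ)) * dotp (hpN (ω i)) (hpN (ω j))) ≤ β) ∧
    (k = 4 →
      opNorm (fun i j : Fin p =>
        (dotp (hpN (ω i)) (hpN (ω j))) ^ k - (if i = j then 1 else 0) -
          3 / (d : ℝ) ^ 2) ≤ β) ∧
    (5 ≤ k →
      opNorm (fun i j : Fin p =>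
        (dotp (hpN (ω i)) (hpN (ω j))) ^ k - (if i = j then 1 else 0)) ≤ β) ∧
    opNorm (fun i j : Fin p => (dotp (hpN (ω i)) (hpN (ω j))) ^ k) ≤ 2 + 6 * hpC1 C0 + 3 * C0 := by
  obtain ⟨h, h3, h4⟩ := hg
  have hC1 := hp_c1_pos hC0
  have hc3 := hp_c3_pos hC0
  have hc4 := hp_c4_pos hC0
  have hm1 : (1 : ℝ) ≤ m := by exact_mod_cast hm
  have hd1 : (1 : ℝ) ≤ d := by exact_mod_cast hd
  set R : ℝ := 4 * m with hRdef
  have hR : 1 ≤ R := h.hR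
  have hMR : (m : ℝ) ≤ R := by rw [hRdef]; linarith
  have hq0 := h.q0
  set q : ℝ := √d with hqdef
  have hq1 : 1 ≤ q := by linarith [h.hq]
  have hq2 : q ^ 2 = d := Real.sq_sqrt (by positivity)
  have hq4 : q ^ 4 = (d : ℝ) ^ 2 := by rw [← hq2]; ring
  have hβ0 : 0 ≤ β := by
    refine le_trans ?_ hβ
    unfold hpB; positivity
  have hI := hp_bb_diag (p := p) Finset.univ 1 1 (by norm_num)
  set t : Fin p → Fin p → ℝ := fun i j => dotp (hpN (ω i)) (hpN (ω j)) with ht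
  have h32 : 3 / q ^ 2 ≤ 3 / q := by
    apply div_le_div_of_nonneg_left (by norm_num) hq0
    exact le_self_pow₀ hq1 (by norm_num)
  have h34 : 3 / q ^ 4 ≤ 3 / q := by
    apply div_le_div_of_nonneg_left (by norm_num) hq0
    exact le_self_pow₀ hq1 (by norm_num)
  have hle : ∀ x : ℝ, x ≤ hpB C0 → x * R ^ 10 / q ≤ β := fun x hx => by
    refine le_trans ?_ hβ
    gcongr
  obtain rfl | rfl | hk5 : k = 3 ∨ k = 4 ∨ 5 ≤ k := by omega
  · have hl := hp_l3 hC0 hR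
    have hn := hp_num 8 (hpc3 C0) (12 * hpC1 C0) (hpL3 C0 R) m R q (by norm_num) hc3.le
      (by positivity) hl.1 hl.2 hR hMR (by positivity) hq0
    have hn2 := hn.trans (hle _ (by unfold hpB; nlinarith [Real.exp_pos 1, mul_pos (Real.exp_pos 1) hc4]))
    have hs : (m : ℝ) * ((8 * √(Real.exp 1 * hpL3 C0 R) + 12 * hpC1 C0 * R) / q) ≤ 1 := by
      have : 0 < 3 / q := by positivity
      linarith
    have hb := (h.three (hpL3 C0 R) hl.1 m hpm hs h3).mono
      ((by linarith : _ ≤ β))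
    refine ⟨fun _ => ?_, fun e => by omega, fun e => by omega, ?_⟩
    · rw [← hq2]
      exact hb.opNorm hβ0
    · refine HpBB.opNorm (by positivity) (((((hb.add hI).add ((h.hW _ _).smul (3 / q ^ 2) (by positivity))).congr ?_)).mono ?_)
      · intro i _ j _
        ring
      · have : 3 / q ^ 2 * (2 * hpC1 C0 * q ^ 2) = 6 * hpC1 C0 := by field_simp; ring
        rw [this]; linarith
  · have hl := hp_l4 hC0 hR
    have hn := hp_num 16 (hpc4 C0) (36 * C0) (hpL4 C0 R) m R q (by norm_num) hc4.le
      (by positivity) hl.1 hl.2 hR hMR (by positivity) hq0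
    have hn2 := hn.trans (hle _ (by unfold hpB; nlinarith [Real.exp_pos 1, mul_pos (Real.exp_pos 1) hc3]))
    have hb := (h.four (hpL4 C0 R) hl.1 m hpm h4).mono
      ((by linarith : _ ≤ β))
    refine ⟨fun e => by omega, fun _ => ?_, fun e => by omega, ?_⟩
    · rw [← hq4]
      exact hb.opNorm hβ0
    · have he : HpBB (fun _ _ : Fin p => 3 / q ^ 4) Finset.univ Finset.univ (p * (3 / q ^ 4)) :=
        hp_bb_entry _ (by positivity) fun i _ j _ => by rw [abs_of_pos (by positivity)]
      refine HpBB.opNorm (by positivity) (((((hb.add hI).add he).congr ?_)).mono ?_)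
      · intro i _ j _
        ring
      · have : p * (3 / q ^ 4) ≤ 3 * C0 := by
          have := h.hp
          rw [← mul_div_assoc, div_le_iff₀ (by positivity)]
          linarith
        linarith
  · have hn2 := hle (32 * C0 * R ^ 5 / R ^ 10) (by
      have : 32 * C0 * R ^ 5 / R ^ 10 ≤ 32 * C0 := by
        rw [div_le_iff₀ (by positivity)]
        have : R ^ 5 ≤ R ^ 10 := pow_le_pow_right₀ hR (by norm_num)
        gcongr
      refine this.trans ?_
      unfold hpB
      exact le_add_of_nonneg_left (by positivity))
    have hb := (h.big k hk5).mono (β' := β) (by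
      refine le_trans (le_of_eq ?_) hn2
      field_simp)
    refine ⟨fun e => by omega, fun e => by omega, fun _ => hb.opNorm hβ0, ?_⟩
    refine HpBB.opNorm (by positivity) ((((hb.add hI).congr ?_)).mono ?_)
    · intro i _ j _
      ring
    · linarith

lemma hp_large (T : ℝ) : ∃ C : ℝ, 0 < C ∧ ∀ x : ℝ, C ≤ x →
    T ≤ Real.log x ∧ Real.log x ^ 22 ≤ x := by
  have h1 := Real.tendsto_log_atTop.eventually_ge_atTop T
  have h2 := (Real.isLittleO_pow_log_id_atTop (n := 22)).bound (c := 1) one_pos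
  have h3 := h1.and (h2.and (Filter.eventually_ge_atTop (1 : ℝ)))
  obtain ⟨C, hC⟩ := Filter.eventually_atTop.mp h3
  refine ⟨max C 1, by positivity, fun x hx => ?_⟩
  obtain ⟨a, b, c⟩ := hC x (le_trans (le_max_left _ _) hx)
  refine ⟨a, ?_⟩
  simp only [id, Real.norm_eq_abs, one_mul] at b
  rw [abs_of_nonneg (by linarith : (0 : ℝ) ≤ x)] at b
  exact (le_abs_self _).trans b

lemma hp_prob_num (C0 D0 : ℝ) (hC0 : 0 < C0) (hD0 : 0 < D0) (m : ℕ) (hp1 : 1 ≤ p)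
    (hp : (p : ℝ) ≤ C0 * d ^ 2) (hd12 : (12 : ℝ) ≤ d) (hdC : C0 ≤ d) (hmd : (m : ℝ) + 1 ≤ d)
    (hm : (20 + 3 * D0) * Real.log d ≤ m) :
    12 * ((p : ℝ) + 1) ^ 4 * (d + 1) * (m + 1) * Real.exp (-m) ≤ (p : ℝ) ^ (-D0) ∧ p ≤ 2 ^ m := by
  have hd0 : (0 : ℝ) < d := by linarith
  have hp0 : (0 : ℝ) < p := by exact_mod_cast hp1
  have hL : 0 < Real.log d := Real.log_pos (by linarith)
  have hp3 : (p : ℝ) ≤ d ^ 3 := hp.trans (by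
    calc C0 * (d : ℝ) ^ 2 ≤ d * d ^ 2 := by gcongr
      _ = _ := by ring)
  have hlogp : Real.log p ≤ 3 * Real.log d := by
    have := Real.log_le_log hp0 hp3
    rwa [Real.log_pow] at this
  have hexp : Real.exp (Real.log d) = d := Real.exp_log hd0
  constructor
  · have h4 : (p : ℝ) + 1 ≤ d ^ 4 := by
      have : (1 : ℝ) ≤ d ^ 3 := one_le_pow₀ (by linarith)
      calc (p : ℝ) + 1 ≤ d ^ 3 * 12 := by linarith
        _ ≤ d ^ 3 * d := by gcongr
        _ = _ := by ring
    have h2 : (d : ℝ) + 1 ≤ d ^ 2 := by nlinarith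
    calc 12 * ((p : ℝ) + 1) ^ 4 * (d + 1) * (m + 1) * Real.exp (-m)
        ≤ d * (d ^ 4) ^ 4 * d ^ 2 * d * Real.exp (-m) := by gcongr
      _ = (d : ℝ) ^ 20 * Real.exp (-m) := by ring
      _ = Real.exp (20 * Real.log d - m) := by
          rw [sub_eq_add_neg, Real.exp_add]
          congr 1
          rw [← Real.exp_log (pow_pos hd0 20), Real.log_pow]
          norm_num
      _ ≤ Real.exp (Real.log p * (-D0)) := by
          apply Real.exp_le_exp.mpr
          nlinarith
      _ = _ := (Real.rpow_def_of_pos hp0 _).symm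
  · have : (p : ℝ) ≤ 2 ^ m := by
      have h2 : (0.5 : ℝ) ≤ Real.log 2 := by linarith [Real.log_two_gt_d9]
      have : Real.log p ≤ Real.log (2 ^ m) := by
        rw [Real.log_pow]
        have hm0 : (0 : ℝ) ≤ m := by positivity
        nlinarith
      exact (Real.log_le_log_iff hp0 (by positivity)).mp this
    exact_mod_cast this

end Final

/-- **Lemma F.5**: the `k`-th entrywise power of the Gram matrix of `p ≤ C₀d²` i.i.d.
uniform points on `S^{d-1}` is an approximate identity plus explicit spikes. -/
theorem hadamard_power_gram (k : ℕ) (hk : 3 ≤ k) (C0 D0 : ℝ) (hC0 : 0 < C0) (hD0 : 0 < D0) :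
    ∃ K C C' : ℝ, 0 < K ∧ 0 < C ∧ 0 < C' ∧
      ∀ d p : ℕ, C ≤ (d : ℝ) → 1 ≤ p → (p : ℝ) ≤ C0 * (d : ℝ) ^ 2 →
        1 - ENNReal.ofReal ((p : ℝ) ^ (-D0)) ≤
          (Measure.pi fun _ : Fin p => unifSphere (Fin d))
            {w | ((k = 3 →
                    opNorm (fun i j : Fin p =>
                        (dotp (w i) (w j)) ^ k - (if i = j then 1 else 0) -
                          (3 / (d : ℝ)) * dotp (w i) (w j)) ≤
                      Real.log d ^ K / Real.sqrt d) ∧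
                  (k = 4 →
                    opNorm (fun i j : Fin p =>
                        (dotp (w i) (w j)) ^ k - (if i = j then 1 else 0) -
                          3 / (d : ℝ) ^ 2) ≤
                      Real.log d ^ K / Real.sqrt d) ∧
                  (5 ≤ k →
                    opNorm (fun i j : Fin p =>
                        (dotp (w i) (w j)) ^ k - (if i = j then 1 else 0)) ≤
                      Real.log d ^ K / Real.sqrt d) ∧
                  opNorm (fun i j : Fin p => (dotp (w i) (w j)) ^ k) ≤ C')} := by
  set A : ℝ := 21 + 3 * D0 with hA
  have hc1 := hp_c1_pos hC0
  have hc3 := hp_c3_pos hC0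
  have hc4 := hp_c4_pos hC0
  have hB : 0 < hpB C0 := by unfold hpB; positivity
  obtain ⟨C1, hC1, hlarge⟩ := hp_large (1 + 8 * A + hpB C0 * (4 * A) ^ 10)
  refine ⟨11, C1 + 12 + C0, 2 + 6 * hpC1 C0 + 3 * C0, by norm_num, by positivity, by positivity, ?_⟩
  intro d p hCd hp1 hp
  obtain ⟨hT, h22⟩ := hlarge d (by linarith)
  have hd12 : (12 : ℝ) ≤ d := by linarith
  have hd0 : (0 : ℝ) < d := by linarith
  have hAp : 0 < A := by positivity
  have hBA : 0 < hpB C0 * (4 * A) ^ 10 := by positivity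
  set L := Real.log d with hL
  have hL1 : 1 ≤ L := by linarith
  set m : ℕ := ⌈(20 + 3 * D0) * L⌉₊ with hmdef
  have hm1 : (20 + 3 * D0) * L ≤ m := Nat.le_ceil _
  have hm2 : (m : ℝ) ≤ A * L := by
    have := (Nat.ceil_lt_add_one (show 0 ≤ (20 + 3 * D0) * L by positivity)).le
    rw [← hmdef] at this
    rw [hA]; nlinarith
  have hm : 1 ≤ m := Nat.one_le_ceil_iff.mpr (by positivity)
  have hmr : (1 : ℝ) ≤ m := by exact_mod_cast hm
  have hq : L ^ 11 ≤ √d := by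
    apply Real.le_sqrt_of_sq_le
    rw [← pow_mul]; exact h22
  have hq0 : 0 < √(d : ℝ) := Real.sqrt_pos.mpr hd0
  have hmd : 8 * (m : ℝ) ≤ √d := by
    calc 8 * (m : ℝ) ≤ (8 * A) * L := by linarith
      _ ≤ L * L := by gcongr; linarith
      _ = L ^ 2 := by ring
      _ ≤ L ^ 11 := pow_le_pow_right₀ hL1 (by norm_num)
      _ ≤ _ := hq
  have hqd : √(d : ℝ) ≤ d := by
    rw [Real.sqrt_le_left hd0.le]; nlinarith
  have hdn : 1 ≤ d := by
    have : (1 : ℝ) ≤ d := by linarith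
    exact_mod_cast this
  obtain ⟨hprob, hpm⟩ := hp_prob_num (p := p) (d := d) C0 D0 hC0 hD0 m hp1 hp hd12 (by linarith)
    (by linarith) hm1
  have hK : L ^ (11 : ℝ) = L ^ 11 := by
    rw [← Real.rpow_natCast]; norm_num
  have hβ : hpB C0 * (4 * (m : ℝ)) ^ 10 / √d ≤ L ^ (11 : ℝ) / √d := by
    rw [hK]
    apply div_le_div_of_nonneg_right _ hq0.le
    calc hpB C0 * (4 * (m : ℝ)) ^ 10 ≤ hpB C0 * (4 * (A * L)) ^ 10 := by gcongr
      _ = (hpB C0 * (4 * A) ^ 10) * L ^ 10 := by ring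
      _ ≤ L * L ^ 10 := by gcongr; linarith
      _ = _ := by ring
  have hβ1 : L ^ (11 : ℝ) / √d ≤ 1 := by
    rw [hK, div_le_one hq0]; exact hq
  have hbad := (hp_good_prob C0 hC0 hdn m hm hmd hp).trans (ENNReal.ofReal_le_ofReal hprob)
  set P := (Measure.pi fun _ : Fin p => stdG (Fin d)) with hP
  have hmap : (Measure.pi fun _ : Fin p => unifSphere (Fin d)) = P.map (fun ω i => hpN (ω i)) := by
    have : SigmaFinite (Measure.map (hpN : (Fin d → ℝ) → _) (stdG (Fin d))) := by
      have := Measure.isProbabilityMeasure_map (μ := stdG (Fin d)) hp_meas_N.aemeasurable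
      infer_instance
    exact (Measure.pi_map_pi (μ := fun _ : Fin p => stdG (Fin d)) (f := fun _ => hpN)
      (fun _ => hp_meas_N.aemeasurable)).symm
  rw [hmap]
  refine le_trans ?_ (Measure.le_map_apply (Measurable.aemeasurable
    (measurable_pi_lambda _ fun i => hp_meas_N.comp (measurable_pi_apply i))) _)
  rw [tsub_le_iff_right]
  have h1 : (1 : ENNReal) = P Set.univ := measure_univ.symm
  rw [h1]
  have h2 : (Set.univ : Set (Fin p → Fin d → ℝ)) ⊆
      {ω | HpGood C0 (4 * m) ω} ∪ {ω | ¬ HpGood C0 (4 * m) ω} := fun ω _ => em _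
  refine (measure_mono h2).trans ((measure_union_le _ _).trans (add_le_add (measure_mono ?_) hbad))
  intro ω hω
  exact hp_final_det k hk C0 hC0 hdn m hm hpm ω hω _ hβ hβ1
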